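/- Let n ≥ 5 and let a : (0,∞) → (0,∞) satisfy (A1) a(α) ≤ α²/4 for all α > 0 and (A2) a(α)/α → +∞ as α → +∞. Then for every Λ > 0 there exists α₀ > 0 such that for every α ≥ α₀ there is no positive ℤⁿ-periodic C⁴ function u : ℝⁿ → ℝ satisfying Δ²u + αΔu + a(α)u = u^{(n+4)/(n−4)} on ℝⁿ and ∫_{[0,1]ⁿ} u^{2n/(n−4)} dx ≤ Λ. -/

import Mathlib

open MeasureTheory Real Filter

noncomputable section

/-- `ℝⁿ` as Euclidean space. -/
abbrev En (n : ℕ) := EuclideanSpace ℝ (Fin n)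

/-- Partial derivative in the `i`-th coordinate direction. -/
def pderiv' {n : ℕ} (i : Fin n) (u : En n → ℝ) : En n → ℝ :=
  fun x => fderiv ℝ u x (EuclideanSpace.single i 1)

/-- The geometers' Laplacian `Δu = -∑ ∂²u/∂xᵢ²`. -/
def lap {n : ℕ} (u : En n → ℝ) : En n → ℝ :=
  fun x => -∑ i, pderiv' i (pderiv' i u) x

/-- The unit cube `[0,1]ⁿ`. -/
def unitCube (n : ℕ) : Set (En n) := {x | ∀ i, x i ∈ Set.Icc (0 : ℝ) 1}

/-- ℤⁿ-periodicity. -/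
def ZPeriodic {n : ℕ} (u : En n → ℝ) : Prop :=
  ∀ (x : En n) (k : Fin n → ℤ),
    u (x + (WithLp.equiv 2 (Fin n → ℝ)).symm (fun i => (k i : ℝ))) = u x


/-! ### Calculus helpers -/

/-- The analysts' Laplacian. -/
def Lp' {n : ℕ} (f : En n → ℝ) : En n → ℝ := fun x => ∑ i, pderiv' i (pderiv' i f) x

/-- Inner product of gradients. -/
def Gr {n : ℕ} (f g : En n → ℝ) : En n → ℝ := fun x => ∑ i, pderiv' i f x * pderiv' i g x

/-- Squared norm of the gradient. -/
def S1 {n : ℕ} (f : En n → ℝ) : En n → ℝ := fun x => ∑ i, (pderiv' i f x) ^ 2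

/-- Squared norm of the Hessian. -/
def S2 {n : ℕ} (f : En n → ℝ) : En n → ℝ := fun x => ∑ i, S1 (pderiv' i f) x

/-- Radial derivative `x · ∇ f`. -/
def Dr {n : ℕ} (f : En n → ℝ) : En n → ℝ := fun x => fderiv ℝ f x x

section calculus
variable {n : ℕ} {f g : En n → ℝ}

lemma pd_contDiff {k m : WithTop ℕ∞} (hf : ContDiff ℝ k f) (h : m + 1 ≤ k) (i : Fin n) :
    ContDiff ℝ m (pderiv' i f) := by
  unfold pderiv'
  exact (hf.fderiv_right h).clm_apply contDiff_const

lemma pd_cs (hf : HasCompactSupport f) (i : Fin n) : HasCompactSupport (pderiv' i f) :=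
  hf.fderiv_apply ℝ _

lemma Dr_contDiff {k m : WithTop ℕ∞} (hf : ContDiff ℝ k f) (h : m + 1 ≤ k) :
    ContDiff ℝ m (Dr f) := by
  unfold Dr
  exact (hf.fderiv_right h).clm_apply contDiff_id

lemma Lp_contDiff {k m : WithTop ℕ∞} (hf : ContDiff ℝ k f) (h : m + 2 ≤ k) :
    ContDiff ℝ m (Lp' f) := by
  unfold Lp'
  refine ContDiff.sum fun i _ => ?_
  exact pd_contDiff (pd_contDiff hf (m := m + 1) (by rw [add_assoc, one_add_one_eq_two]; exact h) i) le_rfl i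

lemma Gr_contDiff {k m : WithTop ℕ∞} (hf : ContDiff ℝ k f) (hg : ContDiff ℝ k g) (h : m + 1 ≤ k) :
    ContDiff ℝ m (Gr f g) := by
  unfold Gr
  exact ContDiff.sum fun i _ => (pd_contDiff hf h i).mul (pd_contDiff hg h i)

lemma S1_contDiff {k m : WithTop ℕ∞} (hf : ContDiff ℝ k f) (h : m + 1 ≤ k) :
    ContDiff ℝ m (S1 f) := by
  unfold S1
  exact ContDiff.sum fun i _ => (pd_contDiff hf h i).pow 2

lemma S2_contDiff {k m : WithTop ℕ∞} (hf : ContDiff ℝ k f) (h : m + 2 ≤ k) :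
    ContDiff ℝ m (S2 f) := by
  unfold S2
  refine ContDiff.sum fun i _ => ?_
  exact S1_contDiff (pd_contDiff hf (m := m + 1) (by rw [add_assoc, one_add_one_eq_two]; exact h) i) le_rfl

lemma pd_add (hf : Differentiable ℝ f) (hg : Differentiable ℝ g) (i : Fin n) :
    pderiv' i (fun x => f x + g x) = fun x => pderiv' i f x + pderiv' i g x := by
  funext x
  unfold pderiv'
  rw [fderiv_fun_add (hf x) (hg x)]; rfl

lemma pd_const_mul (hf : Differentiable ℝ f) (c : ℝ) (i : Fin n) :
    pderiv' i (fun x => c * f x) = fun x => c * pderiv' i f x := by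
  funext x
  unfold pderiv'
  rw [fderiv_const_mul (hf x)]; rfl

lemma pd_mul (hf : Differentiable ℝ f) (hg : Differentiable ℝ g) (i : Fin n) :
    pderiv' i (fun x => f x * g x) = fun x => f x * pderiv' i g x + g x * pderiv' i f x := by
  funext x
  unfold pderiv'
  rw [fderiv_fun_mul (hf x) (hg x)]; rfl

lemma pd_comm (hf : ContDiff ℝ 2 f) (i j : Fin n) :
    pderiv' i (pderiv' j f) = pderiv' j (pderiv' i f) := by
  funext x
  have h1 : DifferentiableAt ℝ (fderiv ℝ f) x :=
    (hf.fderiv_right (m := 1) (by norm_num)).differentiable (by norm_num) x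
  have hs := (hf.contDiffAt (x := x)).isSymmSndFDerivAt (by simp)
  unfold pderiv'
  rw [fderiv_clm_apply h1 (by fun_prop), fderiv_clm_apply h1 (by fun_prop)]
  simpa using hs.eq (EuclideanSpace.single i 1) (EuclideanSpace.single j 1)

lemma pd_Dr (hf : ContDiff ℝ 2 f) (i : Fin n) :
    pderiv' i (Dr f) = fun x => pderiv' i f x + Dr (pderiv' i f) x := by
  funext x
  have h1 : DifferentiableAt ℝ (fderiv ℝ f) x :=
    (hf.fderiv_right (m := 1) (by norm_num)).differentiable (by norm_num) x
  have hs := (hf.contDiffAt (x := x)).isSymmSndFDerivAt (by simp)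
  unfold Dr pderiv'
  rw [fderiv_clm_apply h1 (by fun_prop), fderiv_clm_apply h1 (by fun_prop)]
  simpa using hs.eq (EuclideanSpace.single i 1) x

lemma vec_eq (x : En n) : x = ∑ i, x i • EuclideanSpace.single i (1 : ℝ) := by
  ext j
  simp [Pi.single_apply]

lemma Dr_eq (f : En n → ℝ) (x : En n) : Dr f x = ∑ i, x i * pderiv' i f x := by
  unfold Dr pderiv'
  conv_lhs => arg 2; rw [vec_eq x]
  rw [map_sum]
  simp

lemma Dr_sq_le (f : En n → ℝ) (x : En n) : (Dr f x) ^ 2 ≤ ‖x‖ ^ 2 * S1 f x := by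
  rw [Dr_eq, EuclideanSpace.norm_sq_eq]
  simpa [S1] using Finset.sum_mul_sq_le_sq_mul_sq Finset.univ (fun i => x i) (fun i => pderiv' i f x)

lemma Gr_sq_le (f g : En n → ℝ) (x : En n) : (Gr f g x) ^ 2 ≤ S1 f x * S1 g x :=
  Finset.sum_mul_sq_le_sq_mul_sq Finset.univ (fun i => pderiv' i f x) (fun i => pderiv' i g x)

lemma S1_nonneg (f : En n → ℝ) (x : En n) : 0 ≤ S1 f x := Finset.sum_nonneg fun _ _ => sq_nonneg _

lemma S2_nonneg (f : En n → ℝ) (x : En n) : 0 ≤ S2 f x := Finset.sum_nonneg fun _ _ => S1_nonneg _ _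

lemma Lp_sq_le (f : En n → ℝ) (x : En n) : (Lp' f x) ^ 2 ≤ n * S2 f x := by
  have h := sq_sum_le_card_mul_sum_sq (s := (Finset.univ : Finset (Fin n)))
    (f := fun i => pderiv' i (pderiv' i f) x)
  simp only [Finset.card_univ, Fintype.card_fin] at h
  refine h.trans (mul_le_mul_of_nonneg_left ?_ (by positivity))
  refine Finset.sum_le_sum fun i _ => ?_
  exact Finset.single_le_sum (f := fun j => (pderiv' j (pderiv' i f) x) ^ 2)
    (fun j _ => sq_nonneg _) (Finset.mem_univ i)

lemma Lp_mul (hf : ContDiff ℝ 2 f) (hg : ContDiff ℝ 2 g) (x : En n) :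
    Lp' (fun x => f x * g x) x = f x * Lp' g x + 2 * Gr f g x + g x * Lp' f x := by
  have df := hf.differentiable (by norm_num)
  have dg := hg.differentiable (by norm_num)
  unfold Lp' Gr
  rw [Finset.mul_sum, Finset.mul_sum, Finset.mul_sum, ← Finset.sum_add_distrib,
    ← Finset.sum_add_distrib]
  refine Finset.sum_congr rfl fun i _ => ?_
  have df' := (pd_contDiff hf (m := 1) (by norm_num) i).differentiable (by norm_num)
  have dg' := (pd_contDiff hg (m := 1) (by norm_num) i).differentiable (by norm_num)
  rw [pd_mul df dg, pd_add (f := fun x => f x * pderiv' i g x) (g := fun x => g x * pderiv' i f x) (df.mul dg') (dg.mul df'), pd_mul df dg', pd_mul dg df']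
  ring

lemma ibp (hf : ContDiff ℝ 1 f) (hg : ContDiff ℝ 1 g) (hc : HasCompactSupport g) (i : Fin n) :
    ∫ x, f x * pderiv' i g x = - ∫ x, pderiv' i f x * g x := by
  have cf := (pd_contDiff hf (m := 0) (by norm_num) i).continuous
  have cg := (pd_contDiff hg (m := 0) (by norm_num) i).continuous
  refine integral_mul_fderiv_eq_neg_fderiv_mul_of_integrable ?_ ?_ ?_ ?_ ?_
  · exact (cf.mul hg.continuous).integrable_of_hasCompactSupport hc.mul_left
  · exact (hf.continuous.mul cg).integrable_of_hasCompactSupport (pd_cs hc i).mul_left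
  · exact (hf.continuous.mul hg.continuous).integrable_of_hasCompactSupport hc.mul_left
  · exact fun x _ => hf.differentiable (by norm_num) x
  · exact fun x _ => hg.differentiable (by norm_num) x

lemma int_mul_cs (hf : Continuous f) (hg : Continuous g) (hc : HasCompactSupport g) :
    Integrable (fun x => f x * g x) :=
  (hf.mul hg).integrable_of_hasCompactSupport hc.mul_left

lemma ibpG (hf : ContDiff ℝ 2 f) (hg : ContDiff ℝ 1 g) (hc : HasCompactSupport g) :
    ∫ x, Lp' f x * g x = - ∫ x, Gr f g x := by
  unfold Lp' Gr
  have h1 : ∀ i, ContDiff ℝ 1 (pderiv' i f) := fun i => pd_contDiff hf (by norm_num) i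
  have h2 : ∀ i, Continuous (pderiv' i (pderiv' i f)) := fun i =>
    (pd_contDiff (h1 i) (m := 0) (by norm_num) i).continuous
  have h3 : ∀ i, Continuous (pderiv' i g) := fun i =>
    (pd_contDiff hg (m := 0) (by norm_num) i).continuous
  simp only [Finset.sum_mul]
  rw [integral_finsetSum _ fun i _ => int_mul_cs (h2 i) hg.continuous hc,
    integral_finsetSum _ fun i _ => int_mul_cs (h1 i).continuous (h3 i) (pd_cs hc i),
    ← Finset.sum_neg_distrib]
  refine Finset.sum_congr rfl fun i _ => ?_
  rw [ibp (h1 i) hg hc, neg_neg]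

lemma Gr_comm (f g : En n → ℝ) : Gr f g = Gr g f := by
  funext x; unfold Gr; exact Finset.sum_congr rfl fun i _ => mul_comm _ _

lemma Gr_cs_right (f : En n → ℝ) (hc : HasCompactSupport g) : HasCompactSupport (Gr f g) := by
  refine hc.mono' ?_
  intro x hx
  by_contra h
  apply hx
  unfold Gr
  refine Finset.sum_eq_zero fun i _ => ?_
  have : pderiv' i g x = 0 := by
    unfold pderiv'
    rw [fderiv_of_notMem_tsupport (𝕜 := ℝ) h]; rfl
  rw [this, mul_zero]

lemma Lp_cs (hc : HasCompactSupport g) : HasCompactSupport (Lp' g) := by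
  refine hc.mono' ?_
  intro x hx
  by_contra h
  apply hx
  unfold Lp'
  refine Finset.sum_eq_zero fun i _ => ?_
  have h2 : x ∉ tsupport (pderiv' i g) := fun h3 => h (tsupport_fderiv_apply_subset ℝ _ h3)
  unfold pderiv' at h2 ⊢
  rw [fderiv_of_notMem_tsupport (𝕜 := ℝ) h2]; rfl

lemma ibpL (hf : ContDiff ℝ 2 f) (hg : ContDiff ℝ 2 g) (hc : HasCompactSupport g) :
    ∫ x, Lp' f x * g x = ∫ x, f x * Lp' g x := by
  have h1 : ∀ i, ContDiff ℝ 1 (pderiv' i f) := fun i => pd_contDiff hf (by norm_num) i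
  have h1g : ∀ i, ContDiff ℝ 1 (pderiv' i g) := fun i => pd_contDiff hg (by norm_num) i
  have h2 : ∀ i, Continuous (pderiv' i (pderiv' i g)) := fun i =>
    (pd_contDiff (h1g i) (m := 0) (by norm_num) i).continuous
  rw [ibpG hf (hg.of_le (by norm_num)) hc]
  unfold Lp' Gr
  simp only [Finset.mul_sum]
  rw [integral_finsetSum _ fun i _ => int_mul_cs (h1 i).continuous (h1g i).continuous (pd_cs hc i),
    integral_finsetSum _ fun i _ => int_mul_cs hf.continuous (h2 i) (pd_cs (pd_cs hc i) i),
    ← Finset.sum_neg_distrib]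
  refine Finset.sum_congr rfl fun i _ => ?_
  rw [ibp (hf.of_le (by norm_num)) (h1g i) (pd_cs hc i)]

lemma div_int (hf : ContDiff ℝ 1 f) (hc : HasCompactSupport f) :
    ∫ x, (Dr f x + n * f x) = 0 := by
  have hx : ∀ i : Fin n, ContDiff ℝ 1 (fun x : En n => x i) := fun i => by fun_prop
  have h3 : ∀ i, Continuous (pderiv' i f) := fun i =>
    (pd_contDiff hf (m := 0) (by norm_num) i).continuous
  have key : ∀ i : Fin n, ∫ x : En n, x i * pderiv' i f x = - ∫ x, f x := by
    intro i
    rw [ibp (hx i) hf hc]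
    congr 1
    refine integral_congr_ae (Eventually.of_forall fun x => ?_)
    have : pderiv' i (fun x : En n => x i) x = 1 := by
      unfold pderiv'
      have : (fun x : En n => x i) = (EuclideanSpace.proj i : En n →L[ℝ] ℝ) := by
        ext x; simp
      rw [this, ContinuousLinearMap.fderiv]; simp
    simp [this]
  simp only [Dr_eq]
  rw [integral_add]
  · rw [integral_finsetSum _ fun i _ => int_mul_cs (hx i).continuous (h3 i) (pd_cs hc i)]
    simp only [key, integral_const_mul]
    simp
  · exact integrable_finsetSum _ fun i _ => int_mul_cs (hx i).continuous (h3 i) (pd_cs hc i)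
  · exact int_mul_cs continuous_const hf.continuous hc

/-- Bochner-type identity for compactly supported functions. -/
lemma hess_int (hf : ContDiff ℝ 4 f) (hc : HasCompactSupport f) :
    ∫ x, S2 f x = ∫ x, (Lp' f x) ^ 2 := by
  have h1 : ∀ i, ContDiff ℝ 3 (pderiv' i f) := fun i => pd_contDiff hf (by norm_num) i
  have h2 : ∀ i j, ContDiff ℝ 2 (pderiv' i (pderiv' j f)) := fun i j =>
    pd_contDiff (h1 j) (by norm_num) i
  have h3 : ∀ i j, HasCompactSupport (pderiv' i (pderiv' j f)) := fun i j => pd_cs (pd_cs hc j) i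
  unfold S2 S1 Lp'
  simp only [sq, Finset.sum_mul_sum]
  have ii : ∀ i j k l, Integrable (fun x => pderiv' i (pderiv' j f) x * pderiv' k (pderiv' l f) x) :=
    fun i j k l => int_mul_cs (h2 i j).continuous (h2 k l).continuous (h3 k l)
  rw [integral_finsetSum _ fun i _ => integrable_finsetSum _ fun j _ => ii _ _ _ _,
    integral_finsetSum _ fun i _ => integrable_finsetSum _ fun j _ => ii _ _ _ _]
  refine Finset.sum_congr rfl fun i _ => ?_
  rw [integral_finsetSum _ fun j _ => ii _ _ _ _, integral_finsetSum _ fun j _ => ii _ _ _ _]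
  refine Finset.sum_congr rfl fun j _ => ?_
  -- ∫ ∂j∂i f ∂j∂i f = ∫ ∂i∂i f ∂j∂j f
  rw [ibp ((h2 j i).of_le (by norm_num)) ((h1 i).of_le (by norm_num)) (pd_cs hc i)]
  have e1 : pderiv' j (pderiv' j (pderiv' i f)) = pderiv' i (pderiv' j (pderiv' j f)) := by
    rw [pd_comm (hf.of_le (by norm_num)) j i, pd_comm ((h1 j).of_le (by norm_num)) j i]
  rw [e1]
  have := ibp (f := pderiv' i f) (g := pderiv' j (pderiv' j f)) ((h1 i).of_le (by norm_num)) ((h2 j j).of_le (by norm_num)) (h3 j j) i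
  rw [← neg_eq_iff_eq_neg] at this
  rw [← this]
  simp only [mul_comm]


end calculus

/-! ### Sobolev inequality -/

lemma opnorm_le {n : ℕ} (l : En n →L[ℝ] ℝ) : ‖l‖ ≤ ∑ i, |l (EuclideanSpace.single i 1)| := by
  refine l.opNorm_le_bound (Finset.sum_nonneg fun _ _ => abs_nonneg _) fun x => ?_
  conv_lhs => rw [vec_eq x, map_sum]
  refine (norm_sum_le _ _).trans ?_
  rw [Finset.sum_mul]
  refine Finset.sum_le_sum fun i _ => ?_
  rw [map_smul, norm_smul, mul_comm, Real.norm_eq_abs]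
  exact mul_le_mul_of_nonneg_left (PiLp.norm_apply_le x i) (abs_nonneg _)

open scoped NNReal ENNReal in
lemma gns1 {n : ℕ} (hn : 0 < n) {p p' : ℝ≥0} (hp : 1 ≤ p)
    (hp' : (p' : ℝ)⁻¹ = (p : ℝ)⁻¹ - (n : ℝ)⁻¹) :
    ∃ C : ℝ≥0, ∀ w : En n → ℝ, ContDiff ℝ 1 w → HasCompactSupport w →
      eLpNorm w p' volume ≤ C * ∑ i, eLpNorm (pderiv' i w) p volume := by
  refine ⟨eLpNormLESNormFDerivOfEqInnerConst (volume : Measure (En n)) p, fun w hw hc => ?_⟩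
  refine (eLpNorm_le_eLpNorm_fderiv_of_eq_inner volume hw hc hp (by simpa using hn)
    (by simpa using hp')).trans ?_
  gcongr
  have hm : ∀ i, Continuous (pderiv' i w) := fun i =>
    (pd_contDiff hw (m := 0) (by norm_num) i).continuous
  calc eLpNorm (fderiv ℝ w) p volume
      ≤ eLpNorm (∑ i, fun x => |pderiv' i w x|) p volume := by
        refine eLpNorm_mono_real fun x => ?_
        simpa [pderiv'] using opnorm_le (fderiv ℝ w x)
    _ ≤ ∑ i, eLpNorm (fun x => |pderiv' i w x|) p volume :=
        eLpNorm_sum_le (fun i _ => (hm i).abs.aestronglyMeasurable) (by exact_mod_cast hp)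
    _ = _ := by
        refine Finset.sum_congr rfl fun i _ => ?_
        exact eLpNorm_norm (pderiv' i w)

open scoped NNReal ENNReal in
lemma gns2 {n : ℕ} (hn : 5 ≤ n) :
    ∃ C : ℝ≥0, ∀ w : En n → ℝ, ContDiff ℝ 2 w → HasCompactSupport w →
      eLpNorm w (ENNReal.ofReal (2 * (n : ℝ) / ((n : ℝ) - 4))) volume
        ≤ C * ∑ i, ∑ j, eLpNorm (pderiv' j (pderiv' i w)) 2 volume := by
  have hn' : (5 : ℝ) ≤ n := by exact_mod_cast hn
  obtain ⟨C1, h1⟩ := gns1 (n := n) (by lia) (p := 2) (p' := Real.toNNReal (2 * n / (n - 2)))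
    (by norm_num) (by
      rw [Real.coe_toNNReal _ (by apply div_nonneg <;> linarith)]
      have : (n : ℝ) - 2 ≠ 0 := by linarith
      have : (n : ℝ) ≠ 0 := by linarith
      simp only [NNReal.coe_ofNat]
      field_simp)
  obtain ⟨C2, h2⟩ := gns1 (n := n) (by lia) (p := Real.toNNReal (2 * n / (n - 2)))
    (p' := Real.toNNReal (2 * n / (n - 4)))
    (by
      rw [← Real.toNNReal_one]
      apply Real.toNNReal_le_toNNReal
      rw [le_div_iff₀ (by linarith)]; linarith) (by
      rw [Real.coe_toNNReal _ (by apply div_nonneg <;> linarith),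
        Real.coe_toNNReal _ (by apply div_nonneg <;> linarith)]
      have : (n : ℝ) - 2 ≠ 0 := by linarith
      have : (n : ℝ) - 4 ≠ 0 := by linarith
      have : (n : ℝ) ≠ 0 := by linarith
      field_simp
      ring)
  refine ⟨C2 * C1, fun w hw hc => ?_⟩
  refine (h2 w (hw.of_le (by norm_num)) hc).trans ?_
  rw [ENNReal.coe_mul, mul_assoc, Finset.mul_sum (a := (C1 : ℝ≥0∞))]
  gcongr with i
  exact h1 _ (pd_contDiff hw (by norm_num) i) (pd_cs hc i)

lemma S2_cs {n : ℕ} {g : En n → ℝ} (hc : HasCompactSupport g) : HasCompactSupport (S2 g) := by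
  refine hc.mono' ?_
  intro x hx
  by_contra h
  apply hx
  unfold S2 S1
  refine Finset.sum_eq_zero fun i _ => Finset.sum_eq_zero fun j _ => ?_
  have h2 : x ∉ tsupport (pderiv' i g) := fun h3 => h (tsupport_fderiv_apply_subset ℝ _ h3)
  have : pderiv' j (pderiv' i g) x = 0 := by
    unfold pderiv' at h2 ⊢
    rw [fderiv_of_notMem_tsupport (𝕜 := ℝ) h2]; rfl
  rw [this]; norm_num

open scoped NNReal ENNReal in
lemma sobolev {n : ℕ} (hn : 5 ≤ n) :
    ∃ C : ℝ, 0 < C ∧ ∀ w : En n → ℝ, ContDiff ℝ 2 w → HasCompactSupport w →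
      (∫ x, |w x| ^ (2 * (n : ℝ) / ((n : ℝ) - 4))) ^ (((n : ℝ) - 4) / n) ≤ C * ∫ x, S2 w x := by
  obtain ⟨C, hC⟩ := gns2 hn
  have hn' : (5 : ℝ) ≤ n := by exact_mod_cast hn
  set q : ℝ := 2 * (n : ℝ) / ((n : ℝ) - 4) with hq
  have hq0 : 0 < q := by apply div_pos <;> linarith
  refine ⟨(C * (n * n)) ^ 2 + 1, by positivity, fun w hw hc => ?_⟩
  have hS2c : Continuous (S2 w) := (S2_contDiff hw (m := 0) (by norm_num)).continuous
  have hS2i : Integrable (S2 w) := hS2c.integrable_of_hasCompactSupport (S2_cs hc)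
  have hI0 : 0 ≤ ∫ x, S2 w x := integral_nonneg (S2_nonneg w)
  have hd : ∀ i j, eLpNorm (pderiv' j (pderiv' i w)) 2 volume
      ≤ ENNReal.ofReal (√(∫ x, S2 w x)) := by
    intro i j
    have hcd : Continuous (pderiv' j (pderiv' i w)) :=
      (pd_contDiff (pd_contDiff hw (m := 1) (by norm_num) i) (m := 0) (by norm_num) j).continuous
    have hm : MemLp (pderiv' j (pderiv' i w)) 2 volume :=
      hcd.memLp_of_hasCompactSupport (pd_cs (pd_cs hc i) j)
    rw [hm.eLpNorm_eq_integral_rpow_norm (by norm_num) (by norm_num)]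
    apply ENNReal.ofReal_le_ofReal
    rw [Real.sqrt_eq_rpow]
    simp only [ENNReal.toReal_ofNat, Real.rpow_two, Real.norm_eq_abs, sq_abs, one_div]
    refine Real.rpow_le_rpow (integral_nonneg fun _ => sq_nonneg _) ?_ (by norm_num)
    refine integral_mono_of_nonneg (Eventually.of_forall fun _ => sq_nonneg _) hS2i
      (Eventually.of_forall fun x => ?_)
    refine le_trans ?_ (Finset.single_le_sum (f := fun i => S1 (pderiv' i w) x)
      (fun _ _ => S1_nonneg _ _) (Finset.mem_univ i))
    exact Finset.single_le_sum (f := fun j => (pderiv' j (pderiv' i w) x) ^ 2)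
      (fun _ _ => sq_nonneg _) (Finset.mem_univ j)
  have h := hC w hw hc
  have hmw : MemLp w (ENNReal.ofReal q) volume := hw.continuous.memLp_of_hasCompactSupport hc
  rw [hmw.eLpNorm_eq_integral_rpow_norm (by simpa using hq0) (by simp),
    ENNReal.toReal_ofReal hq0.le] at h
  have h2 : ENNReal.ofReal ((∫ x, ‖w x‖ ^ q) ^ q⁻¹)
      ≤ ENNReal.ofReal (C * (n * n) * √(∫ x, S2 w x)) := by
    refine h.trans ?_
    calc _ ≤ (C : ℝ≥0∞) * ∑ i : Fin n, ∑ j : Fin n, ENNReal.ofReal (√(∫ x, S2 w x)) := by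
          gcongr with i _ j _; exact hd i j
      _ = _ := by
          rw [ENNReal.ofReal_mul (by positivity), ENNReal.ofReal_mul (by positivity),
            ENNReal.ofReal_mul (by positivity)]
          simp [mul_assoc]
  rw [ENNReal.ofReal_le_ofReal_iff (by positivity)] at h2
  simp only [Real.norm_eq_abs] at h2
  set A := ∫ x, |w x| ^ q
  have hA : 0 ≤ A := integral_nonneg fun x => by positivity
  have e : A ^ (((n : ℝ) - 4) / n) = (A ^ q⁻¹) ^ 2 := by
    rw [← Real.rpow_natCast, ← Real.rpow_mul hA]
    congr 1
    have : (n : ℝ) - 4 ≠ 0 := by linarith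
    have : (n : ℝ) ≠ 0 := by linarith
    rw [hq]; push_cast; field_simp
  rw [e]
  calc (A ^ q⁻¹) ^ 2 ≤ (C * (n * n) * √(∫ x, S2 w x)) ^ 2 := by gcongr
    _ = (C * (n * n)) ^ 2 * ∫ x, S2 w x := by rw [mul_pow, Real.sq_sqrt hI0]
    _ ≤ _ := by gcongr; linarith

/-! ### Local estimate -/

section locest
variable {n : ℕ} {f g : En n → ℝ}

lemma pd_zero_of_notMem {x : En n} (h : x ∉ tsupport f) (i : Fin n) : pderiv' i f x = 0 := by
  unfold pderiv'
  rw [fderiv_of_notMem_tsupport (𝕜 := ℝ) h]; rfl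

lemma pd_notMem {x : En n} (h : x ∉ tsupport f) (i : Fin n) : x ∉ tsupport (pderiv' i f) :=
  fun h3 => h (tsupport_fderiv_apply_subset ℝ _ h3)

lemma S1_zero_of_notMem {x : En n} (h : x ∉ tsupport f) : S1 f x = 0 := by
  unfold S1
  exact Finset.sum_eq_zero fun i _ => by rw [pd_zero_of_notMem h]; norm_num

lemma Lp_zero_of_notMem {x : En n} (h : x ∉ tsupport f) : Lp' f x = 0 := by
  unfold Lp'
  exact Finset.sum_eq_zero fun i _ => by rw [pd_zero_of_notMem (pd_notMem h i)]

lemma Gr_zero_of_notMem {x : En n} (h : x ∉ tsupport f) : Gr f g x = 0 := by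
  unfold Gr
  exact Finset.sum_eq_zero fun i _ => by rw [pd_zero_of_notMem h]; norm_num

lemma Dr_zero_of_notMem {x : En n} (h : x ∉ tsupport f) : Dr f x = 0 := by
  unfold Dr
  rw [fderiv_of_notMem_tsupport (𝕜 := ℝ) h]; rfl

lemma S1_cs (hc : HasCompactSupport g) : HasCompactSupport (S1 g) := by
  refine hc.mono' fun x hx => ?_
  by_contra h
  exact hx (S1_zero_of_notMem h)

lemma Dr_cs (hc : HasCompactSupport g) : HasCompactSupport (Dr g) := by
  refine hc.mono' fun x hx => ?_
  by_contra h
  exact hx (Dr_zero_of_notMem h)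

lemma S1_notMem {x : En n} (h : x ∉ tsupport f) : x ∉ tsupport (S1 f) := by
  intro h3
  apply h
  refine closure_minimal (fun y hy => ?_) (isClosed_tsupport f) h3
  by_contra h4
  exact hy (S1_zero_of_notMem h4)

lemma tsupport_sub_ball {R : ℝ} (h : ∀ x, R ≤ ‖x‖ → f x = 0) :
    tsupport f ⊆ Metric.closedBall 0 R := by
  refine closure_minimal (fun y hy => ?_) Metric.isClosed_closedBall
  rw [mem_closedBall_zero_iff]
  by_contra h4
  exact hy (h y (not_le.1 h4).le)

lemma Gr_mul (hf : ContDiff ℝ 1 f) (hg : ContDiff ℝ 1 g) (h : En n → ℝ) (x : En n) :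
    Gr h (fun x => f x * g x) x = f x * Gr h g x + g x * Gr h f x := by
  unfold Gr
  rw [Finset.mul_sum, Finset.mul_sum, ← Finset.sum_add_distrib]
  refine Finset.sum_congr rfl fun i _ => ?_
  rw [pd_mul (hf.differentiable (by norm_num)) (hg.differentiable (by norm_num))]
  ring

lemma S1_eq (f : En n → ℝ) (x : En n) : S1 f x = Gr f f x := by
  unfold S1 Gr
  exact Finset.sum_congr rfl fun i _ => sq _

lemma S1_mul (hf : ContDiff ℝ 1 f) (hg : ContDiff ℝ 1 g) (x : En n) :
    S1 (fun x => f x * g x) x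
      = f x ^ 2 * S1 g x + 2 * f x * g x * Gr f g x + g x ^ 2 * S1 f x := by
  rw [S1_eq, Gr_mul hf hg, Gr_comm _ g, Gr_comm _ f, Gr_mul hf hg, Gr_mul hf hg, Gr_comm g f,
    S1_eq, S1_eq]
  ring

lemma sq_cs (hc : HasCompactSupport f) : HasCompactSupport (fun x => f x ^ 2) := by
  refine hc.mono fun x hx h => hx ?_
  have h' : f x = 0 := h
  simp [h']

lemma int4 {f₁ f₂ f₃ f₄ : En n → ℝ} (h₁ : Integrable f₁) (h₂ : Integrable f₂) (h₃ : Integrable f₃)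
    (h₄ : Integrable f₄) (c₂ c₃ c₄ : ℝ) :
    Integrable (fun x => f₁ x + c₂ * f₂ x + c₃ * f₃ x + c₄ * f₄ x) ∧
    ∫ x, (f₁ x + c₂ * f₂ x + c₃ * f₃ x + c₄ * f₄ x)
      = (∫ x, f₁ x) + c₂ * (∫ x, f₂ x) + c₃ * (∫ x, f₃ x) + c₄ * ∫ x, f₄ x := by
  have j2 := h₂.const_mul c₂
  have j3 := h₃.const_mul c₃
  have j4 := h₄.const_mul c₄
  have k2 : Integrable (fun x => f₁ x + c₂ * f₂ x) := h₁.add j2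
  have k3 : Integrable (fun x => f₁ x + c₂ * f₂ x + c₃ * f₃ x) := k2.add j3
  refine ⟨k3.add j4, ?_⟩
  rw [integral_add k3 j4, integral_add k2 j3, integral_add h₁ j2, integral_const_mul,
    integral_const_mul, integral_const_mul]

/-- The weak form of the equation. -/
lemma weak_form {u φ : En n → ℝ} {α a p : ℝ} (hu : ContDiff ℝ 4 u)
    (hpos : ∀ x, 0 < u x)
    (heq : ∀ x, Lp' (Lp' u) x - α * Lp' u x + a * u x = u x ^ p)
    (hφ : ContDiff ℝ 2 φ) (hc : HasCompactSupport φ) :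
    ∫ x, (Lp' u x * Lp' φ x + α * Gr u φ x + a * (u x * φ x) - u x ^ p * φ x) = 0 := by
  have hLu : ContDiff ℝ 2 (Lp' u) := Lp_contDiff hu (by norm_num)
  have hLLu : Continuous (Lp' (Lp' u)) := (Lp_contDiff hLu (m := 0) (by norm_num)).continuous
  have hup : Continuous (fun x => u x ^ p) :=
    hu.continuous.rpow_const fun x => Or.inl (hpos x).ne'
  have i1 : Integrable (fun x => Lp' u x * Lp' φ x) :=
    int_mul_cs hLu.continuous (Lp_contDiff hφ (m := 0) (by norm_num)).continuous (Lp_cs hc)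
  have i2 : Integrable (Gr u φ) :=
    (Gr_contDiff (hu.of_le (by norm_num)) hφ (m := 0) (k := 2) (by norm_num)).continuous.integrable_of_hasCompactSupport
      (Gr_cs_right _ hc)
  have i3 : Integrable (fun x => u x * φ x) := int_mul_cs hu.continuous hφ.continuous hc
  have i4 : Integrable (fun x => u x ^ p * φ x) := int_mul_cs hup hφ.continuous hc
  have i5 : Integrable (fun x => Lp' (Lp' u) x * φ x) := int_mul_cs hLLu hφ.continuous hc
  have i6 : Integrable (fun x => Lp' u x * φ x) := int_mul_cs hLu.continuous hφ.continuous hc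
  have e1 := ibpL hLu hφ hc
  have e2 := ibpG (f := u) (hu.of_le (by norm_num)) (hφ.of_le (by norm_num)) hc
  have e0 := (int4 i1 i2 i3 i4 α a (-1)).2
  have e0' : ∫ x, (Lp' u x * Lp' φ x + α * Gr u φ x + a * (u x * φ x) - u x ^ p * φ x)
      = ∫ x, (Lp' u x * Lp' φ x + α * Gr u φ x + a * (u x * φ x) + (-1) * (u x ^ p * φ x)) := by
    congr 1; funext x; ring
  rw [e0', e0, ← e1]
  have e3 : ∫ x, Gr u φ x = - ∫ x, Lp' u x * φ x := by rw [e2, neg_neg]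
  rw [e3]
  have e4 : ∫ x, (Lp' (Lp' u) x - α * Lp' u x + a * u x - u x ^ p) * φ x = 0 := by
    have : ∀ x, (Lp' (Lp' u) x - α * Lp' u x + a * u x - u x ^ p) * φ x = 0 := fun x => by
      rw [heq x]; ring
    simp [this]
  have e5 : ∫ x, (Lp' (Lp' u) x - α * Lp' u x + a * u x - u x ^ p) * φ x
      = (∫ x, Lp' (Lp' u) x * φ x) - α * (∫ x, Lp' u x * φ x) + a * (∫ x, u x * φ x)
        - ∫ x, u x ^ p * φ x := by
    have e6 := (int4 i5 i6 i3 i4 (-α) a (-1)).2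
    rw [neg_mul, neg_mul, ← sub_eq_add_neg, ← sub_eq_add_neg, one_mul] at e6
    rw [← e6]
    congr 1; funext x; ring
  rw [e5] at e4
  linarith

lemma exists_bd (hf : Continuous f) (hc : HasCompactSupport f) : ∃ M, 0 ≤ M ∧ ∀ x, |f x| ≤ M := by
  obtain ⟨C, hC⟩ := hc.exists_bound_of_continuous hf
  exact ⟨C, (norm_nonneg _).trans (hC 0), hC⟩

set_option maxHeartbeats 1000000 in
/-- Hoelder + Sobolev: on regions of small energy the nonlinear term is absorbed. -/
lemma holder_sob (hn : 5 ≤ n) : ∃ ε : ℝ, 0 < ε ∧ ∀ (u η : En n → ℝ), ContDiff ℝ 4 u →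
    (∀ x, 0 < u x) → ContDiff ℝ 4 η → HasCompactSupport η →
    (∫ x in {x | η x ≠ 0}, u x ^ (2 * (n : ℝ) / ((n : ℝ) - 4))) ≤ ε →
    ∫ x, η x ^ 2 * u x ^ (2 * (n : ℝ) / ((n : ℝ) - 4))
      ≤ 1 / 2 * ∫ x, S2 (fun x => η x * u x) x := by
  obtain ⟨C, hC0, hC⟩ := sobolev hn
  have hn' : (5 : ℝ) ≤ n := by exact_mod_cast hn
  have hn4 : (0 : ℝ) < n - 4 := by linarith
  have hn0 : (0 : ℝ) < n := by linarith
  set q : ℝ := 2 * (n : ℝ) / ((n : ℝ) - 4) with hq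
  have hq0 : 0 < q := by positivity
  refine ⟨(1 / (2 * C)) ^ ((n : ℝ) / 4), by positivity, fun u η hu hpos hη hc hE => ?_⟩
  set w : En n → ℝ := fun x => η x * u x with hw
  have hwC : ContDiff ℝ 4 w := hη.mul hu
  have hwc : HasCompactSupport w := hc.mul_right
  have hs := hC w (hwC.of_le (by norm_num)) hwc
  set K := tsupport η
  have hK : IsCompact K := hc
  set A : Set (En n) := {x | η x ≠ 0}
  have hAK : A ⊆ K := subset_tsupport η
  have hAm : MeasurableSet A := (isOpen_ne.preimage hη.continuous).measurableSet
  have hcu : ∀ s : ℝ, Continuous (fun x => u x ^ s) := fun s =>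
    hu.continuous.rpow_const fun x => Or.inl (hpos x).ne'
  have hconj : ((n : ℝ) / 4).HolderConjugate (n / (n - 4)) := by
    rw [Real.holderConjugate_iff]
    constructor
    · rw [lt_div_iff₀ (by norm_num)]; linarith
    · field_simp; ring
  have mem1 : MemLp (fun x => u x ^ (8 / ((n : ℝ) - 4))) (ENNReal.ofReal (n / 4))
      (volume.restrict A) := by
    rw [← integrable_norm_rpow_iff (hcu _).aestronglyMeasurable
      (by simp; linarith) (by simp)]
    have h2 : Continuous (fun x => ‖u x ^ (8 / ((n : ℝ) - 4))‖ ^ (ENNReal.ofReal ((n : ℝ) / 4)).toReal) :=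
      (hcu _).norm.rpow_const fun x => Or.inr (by simp)
    exact (h2.continuousOn.integrableOn_compact hK).mono_set hAK
  have mem2 : MemLp (fun x => w x ^ 2) (ENNReal.ofReal (n / (n - 4))) (volume.restrict A) := by
    refine MemLp.restrict _ ?_
    refine (hwC.continuous.pow 2).memLp_of_hasCompactSupport ?_
    exact sq_cs hwc
  have H := integral_mul_le_Lp_mul_Lq_of_nonneg hconj (μ := volume.restrict A)
    (f := fun x => u x ^ (8 / ((n : ℝ) - 4))) (g := fun x => w x ^ 2)
    (Eventually.of_forall fun x => (Real.rpow_pos_of_pos (hpos x) _).le)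
    (Eventually.of_forall fun x => sq_nonneg _) mem1 mem2
  have e1 : ∫ x in A, u x ^ (8 / ((n : ℝ) - 4)) * w x ^ 2 = ∫ x, η x ^ 2 * u x ^ q := by
    rw [setIntegral_eq_integral_of_forall_compl_eq_zero]
    · congr 1; funext x
      rw [hw]
      have : u x ^ q = u x ^ (8 / ((n : ℝ) - 4)) * u x ^ 2 := by
        rw [← Real.rpow_natCast, ← Real.rpow_add (hpos x)]
        congr 1; rw [hq]; push_cast; field_simp; ring
      rw [this]; ring
    · intro x hx
      have : η x = 0 := by simpa [A] using hx
      simp [hw, this]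
  have e2 : ∀ x, (u x ^ (8 / ((n : ℝ) - 4))) ^ ((n : ℝ) / 4) = u x ^ q := fun x => by
    rw [← Real.rpow_mul (hpos x).le]; congr 1; rw [hq]; field_simp; norm_num
  have e3 : ∀ x, (w x ^ 2) ^ ((n : ℝ) / (n - 4)) = |w x| ^ q := fun x => by
    rw [← sq_abs, ← Real.rpow_natCast, ← Real.rpow_mul (abs_nonneg _)]
    congr 1; rw [hq]; push_cast; field_simp
  have e4 : ∫ x in A, |w x| ^ q = ∫ x, |w x| ^ q := by
    rw [setIntegral_eq_integral_of_forall_compl_eq_zero]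
    intro x hx
    have : η x = 0 := by simpa [A] using hx
    simp [hw, this, Real.zero_rpow hq0.ne']
  simp only [e2, e3] at H
  rw [e1, e4] at H
  have hE0 : 0 ≤ ∫ x in A, u x ^ q := integral_nonneg fun x => (Real.rpow_pos_of_pos (hpos x) _).le
  have h5 : (∫ x in A, u x ^ q) ^ (1 / ((n : ℝ) / 4)) ≤ 1 / (2 * C) := by
    calc _ ≤ ((1 / (2 * C)) ^ ((n : ℝ) / 4)) ^ (1 / ((n : ℝ) / 4)) :=
          Real.rpow_le_rpow hE0 hE (by positivity)
      _ = 1 / (2 * C) := by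
          rw [← Real.rpow_mul (by positivity), mul_one_div_cancel (by positivity), Real.rpow_one]
  have e6 : 1 / ((n : ℝ) / (n - 4)) = ((n : ℝ) - 4) / n := by field_simp
  rw [e6] at H
  have hS0 : 0 ≤ ∫ x, S2 w x := integral_nonneg (S2_nonneg w)
  calc _ ≤ _ := H
    _ ≤ 1 / (2 * C) * (C * ∫ x, S2 w x) := by
        refine mul_le_mul h5 hs ?_ (by positivity)
        exact Real.rpow_nonneg (integral_nonneg fun x => by positivity) _
    _ = _ := by field_simp

set_option maxHeartbeats 1000000 in
lemma local_est (hn : 5 ≤ n) : ∃ ε : ℝ, 0 < ε ∧ ∀ (η : En n → ℝ) (R : ℝ),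
    ContDiff ℝ 4 η → (∀ x, R ≤ ‖x‖ → η x = 0) → ∃ C : ℝ, 0 ≤ C ∧
    ∀ (u : En n → ℝ) (α a : ℝ), ContDiff ℝ 4 u → (∀ x, 0 < u x) → 0 ≤ α → 0 ≤ a →
    (∀ x, Lp' (Lp' u) x - α * Lp' u x + a * u x = u x ^ (((n : ℝ) + 4) / ((n : ℝ) - 4))) →
    (∫ x in {x | η x ≠ 0}, u x ^ (2 * (n : ℝ) / ((n : ℝ) - 4))) ≤ ε →
    ∫ x, (S2 (fun x => η x * u x) x + α * S1 (fun x => η x * u x) x + a * (η x * u x) ^ 2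
        + η x ^ 2 * u x ^ (2 * (n : ℝ) / ((n : ℝ) - 4)))
      ≤ C * ∫ x in Metric.closedBall 0 R, (S1 u x + (1 + α) * u x ^ 2) := by
  obtain ⟨ε, hε, H⟩ := holder_sob hn
  have hn' : (5 : ℝ) ≤ n := by exact_mod_cast hn
  have hn4 : (0 : ℝ) < n - 4 := by linarith
  refine ⟨ε, hε, fun η R hη hηR => ?_⟩
  have hts := tsupport_sub_ball hηR
  have hc : HasCompactSupport η :=
    HasCompactSupport.of_support_subset_isCompact (isCompact_closedBall 0 R)
      ((subset_tsupport η).trans hts)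
  have hS1η : ContDiff ℝ 3 (S1 η) := S1_contDiff hη (by norm_num)
  obtain ⟨M1, hM1, bd1⟩ := exists_bd hS1η.continuous (S1_cs hc)
  obtain ⟨M2, hM2, bd2⟩ := exists_bd (S1_contDiff hS1η (m := 0) (by norm_num)).continuous (S1_cs (S1_cs hc))
  obtain ⟨M3, hM3, bd3⟩ := exists_bd (Lp_contDiff hη (m := 0) (by norm_num)).continuous (Lp_cs hc)
  set C0 : ℝ := 10 * M1 + M2 + 2 * M3 ^ 2 + 1 with hC0
  have hC0p : 0 ≤ C0 := by positivity
  refine ⟨4 * C0, by positivity, fun u α a hu hpos hα ha heq hE => ?_⟩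
  have Hh := H u η hu hpos hη hc hE
  set q : ℝ := 2 * (n : ℝ) / ((n : ℝ) - 4) with hq
  set w : En n → ℝ := fun x => η x * u x with hw
  have hwC : ContDiff ℝ 4 w := hη.mul hu
  have hwc : HasCompactSupport w := hc.mul_right
  have hu1 : ContDiff ℝ 1 u := hu.of_le (by norm_num)
  have hu2 : ContDiff ℝ 2 u := hu.of_le (by norm_num)
  have hη1 : ContDiff ℝ 1 η := hη.of_le (by norm_num)
  have hη2 : ContDiff ℝ 2 η := hη.of_le (by norm_num)
  have hw1 : ContDiff ℝ 1 w := hwC.of_le (by norm_num)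
  have hw2 : ContDiff ℝ 2 w := hwC.of_le (by norm_num)
  -- test function
  have hφ : ContDiff ℝ 2 (fun x => η x * w x) := hη2.mul hw2
  have hφc : HasCompactSupport (fun x => η x * w x) := hc.mul_right
  have W := weak_form hu hpos heq hφ hφc
  -- auxiliary integration by parts
  have hψ : ContDiff ℝ 1 (fun x => S1 η x * u x) := (hS1η.of_le (by norm_num)).mul hu1
  have hψc : HasCompactSupport (fun x => S1 η x * u x) := (S1_cs hc).mul_right
  have W2 := ibpG hu2 hψ hψc
  -- integrability
  have cup : Continuous (fun x => u x ^ q) :=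
    hu.continuous.rpow_const fun x => Or.inl (hpos x).ne'
  have iS2 : Integrable (S2 w) :=
    (S2_contDiff hw2 (m := 0) (by norm_num)).continuous.integrable_of_hasCompactSupport (S2_cs hwc)
  have iLw : Integrable (fun x => Lp' w x ^ 2) :=
    ((Lp_contDiff hw2 (m := 0) (by norm_num)).continuous.pow 2).integrable_of_hasCompactSupport
      (sq_cs (Lp_cs hwc))
  have iS1 : Integrable (S1 w) :=
    (S1_contDiff hw1 (m := 0) (by norm_num)).continuous.integrable_of_hasCompactSupport (S1_cs hwc)
  have iw : Integrable (fun x => w x ^ 2) :=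
    (hwC.continuous.pow 2).integrable_of_hasCompactSupport
      (sq_cs hwc)
  have inl : Integrable (fun x => η x ^ 2 * u x ^ q) :=
    ((hη.continuous.pow 2).mul cup).integrable_of_hasCompactSupport
      (HasCompactSupport.mul_right (sq_cs hc))
  have iLψ : Integrable (fun x => Lp' u x * (S1 η x * u x)) :=
    int_mul_cs (Lp_contDiff hu2 (m := 0) (by norm_num)).continuous hψ.continuous hψc
  have iGψ : Integrable (Gr u (fun x => S1 η x * u x)) :=
    (Gr_contDiff hu1 hψ (m := 0) (by norm_num)).continuous.integrable_of_hasCompactSupport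
      (Gr_cs_right _ hψc)
  -- error term
  set Er : En n → ℝ := fun x => 2 * Gr u (fun x => S1 η x * u x) x
    + (2 * Gr η u x + u x * Lp' η x) ^ 2 + α * (S1 η x * u x ^ 2) with hEr
  set J := ∫ x in Metric.closedBall 0 R, (S1 u x + (1 + α) * u x ^ 2) with hJ
  have cGη : Continuous (Gr η u) := (Gr_contDiff hη1 hu1 (m := 0) (by norm_num)).continuous
  have cLη : Continuous (Lp' η) := (Lp_contDiff hη2 (m := 0) (by norm_num)).continuous
  have cEr : Continuous Er := by
    have h1 : Continuous (Gr u (fun x => S1 η x * u x)) :=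
      (Gr_contDiff hu1 hψ (m := 0) (by norm_num)).continuous
    have h4 := hS1η.continuous
    have h5 := hu.continuous
    fun_prop
  have Er0 : ∀ x, x ∉ tsupport η → Er x = 0 := by
    intro x hx
    simp only [hEr]
    rw [Gr_mul (hS1η.of_le (by norm_num)) hu1, Gr_comm u (S1 η), Gr_zero_of_notMem (S1_notMem hx),
      Gr_zero_of_notMem hx, Lp_zero_of_notMem hx, S1_zero_of_notMem hx]
    ring
  have iEr : Integrable Er := cEr.integrable_of_hasCompactSupport
    (hc.mono' fun x hx => by by_contra h; exact hx (Er0 x h))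
  have cJ : Continuous (fun x => S1 u x + (1 + α) * u x ^ 2) := by
    have h1 := (S1_contDiff hu1 (m := 0) (by norm_num)).continuous
    have h5 := hu.continuous
    fun_prop
  have bEr : ∀ x, Er x ≤ C0 * (S1 u x + (1 + α) * u x ^ 2) := by
    intro x
    have b1 := (abs_le.1 (bd1 x)).2
    have b2 := (abs_le.1 (bd2 x)).2
    have b3 : Lp' η x ^ 2 ≤ M3 ^ 2 := by rw [← sq_abs]; exact pow_le_pow_left₀ (abs_nonneg _) (bd3 x) 2
    have g1 := Gr_sq_le u (S1 η) x
    have g2 := Gr_sq_le η u x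
    have s1 := S1_nonneg u x
    have s2 := S1_nonneg η x
    simp only [hEr]
    rw [Gr_mul (hS1η.of_le (by norm_num)) hu1, ← S1_eq]
    have t1 : S1 η x * S1 u x ≤ M1 * S1 u x := mul_le_mul_of_nonneg_right b1 s1
    have t2 : S1 u x * S1 (S1 η) x ≤ S1 u x * M2 := mul_le_mul_of_nonneg_left b2 s1
    have t3 : 2 * (u x * Gr u (S1 η) x) ≤ u x ^ 2 + M2 * S1 u x := by
      nlinarith [sq_nonneg (u x - Gr u (S1 η) x)]
    have t4 : (2 * Gr η u x + u x * Lp' η x) ^ 2 ≤ 8 * (M1 * S1 u x) + 2 * (u x ^ 2 * M3 ^ 2) := by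
      have := mul_le_mul_of_nonneg_left b3 (sq_nonneg (u x))
      nlinarith [sq_nonneg (2 * Gr η u x - u x * Lp' η x)]
    have t5 : α * (S1 η x * u x ^ 2) ≤ α * (M1 * u x ^ 2) :=
      mul_le_mul_of_nonneg_left (mul_le_mul_of_nonneg_right b1 (sq_nonneg _)) hα
    have p1 : 0 ≤ α * u x ^ 2 := by positivity
    have p2 : 0 ≤ u x ^ 2 := by positivity
    have f1 : 0 ≤ M1 * u x ^ 2 := by positivity
    have f2 : 0 ≤ M2 * u x ^ 2 := by positivity
    have f3 : 0 ≤ M3 ^ 2 * S1 u x := by positivity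
    have f4 : 0 ≤ M1 * (α * u x ^ 2) := by positivity
    have f5 : 0 ≤ M2 * (α * u x ^ 2) := by positivity
    have f6 : 0 ≤ M3 ^ 2 * (α * u x ^ 2) := by positivity
    rw [hC0]
    nlinarith
  have hErJ : ∫ x, Er x ≤ C0 * J := by
    rw [← setIntegral_eq_integral_of_forall_compl_eq_zero (s := Metric.closedBall 0 R)
      (fun x hx => Er0 x fun h => hx (hts h)), hJ, ← integral_const_mul]
    refine setIntegral_mono_on iEr.integrableOn ?_ measurableSet_closedBall fun x _ => bEr x
    exact (cJ.continuousOn.integrableOn_compact (isCompact_closedBall 0 R)).const_mul C0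
  -- identity
  have ID : (∫ x, Lp' w x ^ 2) + α * (∫ x, S1 w x) + a * (∫ x, w x ^ 2)
      - (∫ x, η x ^ 2 * u x ^ q) = ∫ x, Er x := by
    have i0 := int4 iLw iS1 iw inl α a (-1)
    have k1 := int4 i0.1 iEr iLψ iGψ (-1) 2 2
    have k3 : (∫ x, Lp' u x * (S1 η x * u x)) + ∫ x, Gr u (fun x => S1 η x * u x) x = 0 := by
      rw [W2]; ring
    have k4 := k1.2
    rw [i0.2] at k4
    suffices hs : ∫ x, (Lp' w x ^ 2 + α * S1 w x + a * w x ^ 2 + (-1) * (η x ^ 2 * u x ^ q)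
        + (-1) * Er x + 2 * (Lp' u x * (S1 η x * u x))
        + 2 * Gr u (fun x => S1 η x * u x) x) = 0 by
      rw [hs] at k4
      linarith
    rw [← W]
    congr 1; funext x
    have e1 : Lp' (fun x => η x * w x) x = η x * Lp' w x + 2 * Gr η w x + w x * Lp' η x :=
      Lp_mul hη2 hw2 x
    have e2 : Lp' w x = η x * Lp' u x + 2 * Gr η u x + u x * Lp' η x := Lp_mul hη2 hu2 x
    have e3 : Gr η w x = η x * Gr η u x + u x * S1 η x := by rw [S1_eq]; exact Gr_mul hη1 hu1 η x
    have e4 : Gr u (fun x => η x * w x) x = η x * Gr u w x + w x * Gr u η x := Gr_mul hη1 hw1 u x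
    have e5 : Gr u w x = η x * S1 u x + u x * Gr u η x := by rw [S1_eq]; exact Gr_mul hη1 hu1 u x
    have e6 : S1 w x = η x ^ 2 * S1 u x + 2 * η x * u x * Gr η u x + u x ^ 2 * S1 η x :=
      S1_mul hη1 hu1 x
    have e7 : u x ^ q = u x ^ (((n : ℝ) + 4) / ((n : ℝ) - 4)) * u x := by
      rw [← Real.rpow_add_one (hpos x).ne']; congr 1; rw [hq]; field_simp; ring
    simp only [hEr]
    rw [e1, e3, e4, e5, e6, e2, e7, Gr_comm u η]
    simp only [hw]
    ring
  have hB := hess_int hwC hwc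
  have sum_eq : ∫ x, (S2 w x + α * S1 w x + a * (η x * u x) ^ 2 + η x ^ 2 * u x ^ q)
      = (∫ x, S2 w x) + α * (∫ x, S1 w x) + a * (∫ x, w x ^ 2) + ∫ x, η x ^ 2 * u x ^ q := by
    have := (int4 iS2 iS1 iw inl α a 1).2
    rw [one_mul] at this
    rw [← this]
    congr 1; funext x; rw [one_mul]
  rw [sum_eq]
  have p1 : 0 ≤ α * ∫ x, S1 w x := mul_nonneg hα (integral_nonneg (S1_nonneg w))
  have p2 : 0 ≤ a * ∫ x, w x ^ 2 := mul_nonneg ha (integral_nonneg fun x => sq_nonneg _)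
  have p3 : 0 ≤ ∫ x, S2 w x := integral_nonneg (S2_nonneg w)
  linarith

end locest

/-! ### Pohozaev identity -/

section poho
variable {n : ℕ} {f g : En n → ℝ}

lemma Dr_mul (hf : Differentiable ℝ f) (hg : Differentiable ℝ g) (x : En n) :
    Dr (fun x => f x * g x) x = f x * Dr g x + g x * Dr f x := by
  unfold Dr
  rw [fderiv_fun_mul (hf x) (hg x)]; rfl

lemma Dr_Lp (hf : ContDiff ℝ 3 f) (x : En n) :
    Dr (Lp' f) x = ∑ i, Dr (pderiv' i (pderiv' i f)) x := by
  unfold Dr Lp'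
  have h : ∀ i, DifferentiableAt ℝ (pderiv' i (pderiv' i f)) x := fun i =>
    (pd_contDiff (pd_contDiff hf (m := 2) (by norm_num) i) (m := 1) (by norm_num) i).differentiable
      (by norm_num) x
  rw [fderiv_fun_sum (fun i _ => h i)]
  simp

lemma Dr_S1 (hf : ContDiff ℝ 2 f) (x : En n) :
    Dr (S1 f) x = 2 * ∑ i, pderiv' i f x * Dr (pderiv' i f) x := by
  have h : ∀ i, Differentiable ℝ (pderiv' i f) := fun i =>
    (pd_contDiff hf (m := 1) (by norm_num) i).differentiable (by norm_num)
  have e : S1 f = fun x => ∑ i, pderiv' i f x * pderiv' i f x := by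
    funext x; unfold S1; exact Finset.sum_congr rfl fun i _ => sq _
  rw [e]
  have : Dr (fun x => ∑ i, pderiv' i f x * pderiv' i f x) x
      = ∑ i, Dr (fun x => pderiv' i f x * pderiv' i f x) x := by
    unfold Dr
    rw [fderiv_fun_sum (fun i _ => (h i x).fun_mul (h i x))]
    simp
  rw [this, Finset.mul_sum]
  refine Finset.sum_congr rfl fun i _ => ?_
  rw [Dr_mul (h i) (h i)]; ring

/-- the Pohozaev multiplier without cutoff -/
def Ps (m : ℝ) (u : En n → ℝ) : En n → ℝ := fun x => Dr u x + m * u x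

lemma Ps_contDiff {u : En n → ℝ} (hu : ContDiff ℝ 4 u) (m : ℝ) : ContDiff ℝ 3 (Ps m u) :=
  (Dr_contDiff hu (by norm_num)).add (contDiff_const.mul (hu.of_le (by norm_num)))

lemma pd_Ps {u : En n → ℝ} (hu : ContDiff ℝ 2 u) (m : ℝ) (i : Fin n) :
    pderiv' i (Ps m u) = fun x => (m + 1) * pderiv' i u x + Dr (pderiv' i u) x := by
  have d1 : Differentiable ℝ u := hu.differentiable (by norm_num)
  have d2 : Differentiable ℝ (Dr u) :=
    (Dr_contDiff hu (m := 1) (by norm_num)).differentiable (by norm_num)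
  unfold Ps
  rw [pd_add d2 (d1.const_mul m), pd_Dr hu, pd_const_mul d1]
  funext x; ring

lemma Lp_Ps {u : En n → ℝ} (hu : ContDiff ℝ 3 u) (m : ℝ) (x : En n) :
    Lp' (Ps m u) x = (m + 2) * Lp' u x + Dr (Lp' u) x := by
  rw [Dr_Lp hu]
  unfold Lp'
  rw [Finset.mul_sum, ← Finset.sum_add_distrib]
  refine Finset.sum_congr rfl fun i _ => ?_
  have c1 : ContDiff ℝ 2 (pderiv' i u) := pd_contDiff hu (by norm_num) i
  have d1 : Differentiable ℝ (pderiv' i u) := c1.differentiable (by norm_num)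
  have d2 : Differentiable ℝ (Dr (pderiv' i u)) :=
    (Dr_contDiff c1 (m := 1) (by norm_num)).differentiable (by norm_num)
  rw [pd_Ps (hu.of_le (by norm_num)), pd_add (d1.const_mul _) d2, pd_const_mul d1, pd_Dr c1]
  ring

lemma Gr_Ps {u : En n → ℝ} (hu : ContDiff ℝ 2 u) (m : ℝ) (x : En n) :
    Gr u (Ps m u) x = (m + 1) * S1 u x + ∑ i, pderiv' i u x * Dr (pderiv' i u) x := by
  unfold Gr S1
  rw [Finset.mul_sum, ← Finset.sum_add_distrib]
  refine Finset.sum_congr rfl fun i _ => ?_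
  rw [pd_Ps hu]; ring

lemma S1_Ps_le {u : En n → ℝ} (hu : ContDiff ℝ 2 u) (m : ℝ) (x : En n) :
    S1 (Ps m u) x ≤ 2 * (m + 1) ^ 2 * S1 u x + 2 * ‖x‖ ^ 2 * S2 u x := by
  unfold S2
  conv_lhs => unfold S1
  conv_rhs => enter [1]; unfold S1
  rw [Finset.mul_sum, Finset.mul_sum, ← Finset.sum_add_distrib]
  refine Finset.sum_le_sum fun i _ => ?_
  rw [pd_Ps hu]
  have := Dr_sq_le (pderiv' i u) x
  nlinarith [sq_nonneg ((m + 1) * pderiv' i u x - Dr (pderiv' i u) x)]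

/-- energy density -/
def En' (α a q : ℝ) (u : En n → ℝ) : En n → ℝ :=
  fun x => 1 / 2 * (Lp' u x * Lp' u x) + α / 2 * S1 u x + a / 2 * (u x * u x) - 1 / q * u x ^ q

lemma En_contDiff {u : En n → ℝ} (hu : ContDiff ℝ 4 u) (hpos : ∀ x, 0 < u x) (α a q : ℝ) :
    ContDiff ℝ 1 (En' α a q u) := by
  have h1 : ContDiff ℝ 1 (Lp' u) := Lp_contDiff hu (by norm_num)
  have h2 : ContDiff ℝ 1 (S1 u) := S1_contDiff hu (by norm_num)
  have h3 : ContDiff ℝ 1 u := hu.of_le (by norm_num)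
  have h4 : ContDiff ℝ 1 (fun x => u x ^ q) := h3.rpow_const_of_ne fun x => (hpos x).ne'
  unfold En'
  exact (((contDiff_const.mul (h1.mul h1)).add (contDiff_const.mul h2)).add
    (contDiff_const.mul (h3.mul h3))).sub (contDiff_const.mul h4)

lemma Dr_En {u : En n → ℝ} (hu : ContDiff ℝ 4 u) (hpos : ∀ x, 0 < u x) (α a q : ℝ) (hq : q ≠ 0)
    (x : En n) :
    Dr (En' α a q u) x = Lp' u x * Dr (Lp' u) x
      + α * (∑ i, pderiv' i u x * Dr (pderiv' i u) x) + a * (u x * Dr u x)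
      - u x ^ (q - 1) * Dr u x := by
  have hS := Dr_S1 (hu.of_le (by norm_num) : ContDiff ℝ 2 u) x
  have h1 : ContDiff ℝ 1 (Lp' u) := Lp_contDiff hu (by norm_num)
  have h2 : ContDiff ℝ 1 (S1 u) := S1_contDiff hu (by norm_num)
  have d1 := (h1.differentiable (by norm_num) x).hasFDerivAt
  have d2 := (h2.differentiable (by norm_num) x).hasFDerivAt
  have d3 := (hu.differentiable (by norm_num) x).hasFDerivAt
  have d4 := d3.rpow_const (p := q) (Or.inl (hpos x).ne')
  have d := ((((d1.mul d1).const_mul (1 / 2)).add (d2.const_mul (α / 2))).add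
    ((d3.mul d3).const_mul (a / 2))).sub (d4.const_mul (1 / q))
  have e := congrArg (fun l : En n →L[ℝ] ℝ => l x) (HasFDerivAt.fderiv (f := En' α a q u) d)
  have hS' : fderiv ℝ (S1 u) x x = 2 * ∑ i, pderiv' i u x * Dr (pderiv' i u) x := hS
  have hL : fderiv ℝ (Lp' u) x x = Dr (Lp' u) x := rfl
  have hU : fderiv ℝ u x x = Dr u x := rfl
  rw [show Dr (En' α a q u) x = fderiv ℝ (En' α a q u) x x from rfl]
  refine e.trans ?_
  simp only [ContinuousLinearMap.sub_apply, ContinuousLinearMap.add_apply,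
    ContinuousLinearMap.smul_apply, smul_eq_mul]
  rw [hS', hL, hU]
  field_simp
  ring

/-- error in the localized Pohozaev identity -/
def PE (α a q m : ℝ) (χ u : En n → ℝ) : En n → ℝ := fun x =>
  Lp' u x * (2 * Gr χ (Ps m u) x + Ps m u x * Lp' χ x) + α * (Ps m u x * Gr u χ x)
    - Dr χ x * En' α a q u x

lemma poho_id (hn : 5 ≤ n) {χ u : En n → ℝ} {α a : ℝ} (hχ : ContDiff ℝ 4 χ)
    (hc : HasCompactSupport χ) (hu : ContDiff ℝ 4 u) (hpos : ∀ x, 0 < u x)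
    (heq : ∀ x, Lp' (Lp' u) x - α * Lp' u x + a * u x = u x ^ (((n : ℝ) + 4) / ((n : ℝ) - 4))) :
    ∫ x, χ x * (α * S1 u x + 2 * a * u x ^ 2)
      = ∫ x, PE α a (2 * (n : ℝ) / ((n : ℝ) - 4)) (((n : ℝ) - 4) / 2) χ u x := by
  have hn' : (5 : ℝ) ≤ n := by exact_mod_cast hn
  have hn4 : (0 : ℝ) < n - 4 := by linarith
  have hn0 : (0 : ℝ) < n := by linarith
  set q : ℝ := 2 * (n : ℝ) / ((n : ℝ) - 4) with hq
  set m : ℝ := ((n : ℝ) - 4) / 2 with hm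
  set p : ℝ := ((n : ℝ) + 4) / ((n : ℝ) - 4) with hp
  have hq0 : q ≠ 0 := by positivity
  have hqp : q - 1 = p := by rw [hq, hp]; field_simp; ring
  have hu2 : ContDiff ℝ 2 u := hu.of_le (by norm_num)
  have hu1 : ContDiff ℝ 1 u := hu.of_le (by norm_num)
  have hχ2 : ContDiff ℝ 2 χ := hχ.of_le (by norm_num)
  have hχ1 : ContDiff ℝ 1 χ := hχ.of_le (by norm_num)
  have hψ3 := Ps_contDiff hu m
  have hψ2 : ContDiff ℝ 2 (Ps m u) := hψ3.of_le (by norm_num)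
  have hψ1 : ContDiff ℝ 1 (Ps m u) := hψ3.of_le (by norm_num)
  have hφ : ContDiff ℝ 2 (fun x => χ x * Ps m u x) := hχ2.mul hψ2
  have hφc : HasCompactSupport (fun x => χ x * Ps m u x) := hc.mul_right
  have hE1 := En_contDiff hu hpos α a q
  have hχE : ContDiff ℝ 1 (fun x => χ x * En' α a q u x) := hχ1.mul hE1
  have hχEc : HasCompactSupport (fun x => χ x * En' α a q u x) := hc.mul_right
  have W := weak_form hu hpos heq hφ hφc
  have V := div_int hχE hχEc
  have cup : Continuous (fun x => u x ^ p) :=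
    hu.continuous.rpow_const fun x => Or.inl (hpos x).ne'
  have iW : Integrable (fun x => Lp' u x * Lp' (fun x => χ x * Ps m u x) x
      + α * Gr u (fun x => χ x * Ps m u x) x
      + a * (u x * (χ x * Ps m u x)) - u x ^ p * (χ x * Ps m u x)) := by
    have i1 : Integrable (fun x => Lp' u x * Lp' (fun x => χ x * Ps m u x) x) :=
      int_mul_cs (Lp_contDiff hu2 (m := 0) (by norm_num)).continuous
        (Lp_contDiff hφ (m := 0) (by norm_num)).continuous (Lp_cs hφc)
    have i2 : Integrable (Gr u (fun x => χ x * Ps m u x)) :=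
      (Gr_contDiff hu2 hφ (m := 0) (by norm_num)).continuous.integrable_of_hasCompactSupport
        (Gr_cs_right _ hφc)
    have i3 : Integrable (fun x => u x * (χ x * Ps m u x)) :=
      int_mul_cs hu.continuous hφ.continuous hφc
    have i4 : Integrable (fun x => u x ^ p * (χ x * Ps m u x)) := int_mul_cs cup hφ.continuous hφc
    exact ((i1.add (i2.const_mul α)).add (i3.const_mul a)).sub i4
  have iV : Integrable (fun x => Dr (fun x => χ x * En' α a q u x) x
      + n * (χ x * En' α a q u x)) := by
    have i1 : Integrable (Dr (fun x => χ x * En' α a q u x)) :=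
      (Dr_contDiff hχE (m := 0) (by norm_num)).continuous.integrable_of_hasCompactSupport
        (Dr_cs hχEc)
    exact i1.add ((hχE.continuous.integrable_of_hasCompactSupport hχEc).const_mul _)
  have iM : Integrable (fun x => χ x * (α * S1 u x + 2 * a * u x ^ 2)) := by
    have h1 := (S1_contDiff hu1 (m := 0) (by norm_num)).continuous
    have h2 := hu.continuous
    have h3 := hχ.continuous
    have : Continuous (fun x => χ x * (α * S1 u x + 2 * a * u x ^ 2)) := by fun_prop
    exact this.integrable_of_hasCompactSupport hc.mul_right
  have pt : ∀ x, PE α a q m χ u x = (Lp' u x * Lp' (fun x => χ x * Ps m u x) x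
      + α * Gr u (fun x => χ x * Ps m u x) x
      + a * (u x * (χ x * Ps m u x)) - u x ^ p * (χ x * Ps m u x))
      - (Dr (fun x => χ x * En' α a q u x) x + n * (χ x * En' α a q u x))
      + χ x * (α * S1 u x + 2 * a * u x ^ 2) := by
    intro x
    have e1 := Lp_mul hχ2 hψ2 x
    have e2 := Gr_mul hχ1 hψ1 u x
    have e3 := Dr_mul (hχ1.differentiable (by norm_num)) (hE1.differentiable (by norm_num)) x
    have e4 := Dr_En hu hpos α a q hq0 x
    have e5 := Lp_Ps (hu.of_le (by norm_num) : ContDiff ℝ 3 u) m x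
    have e6 := Gr_Ps hu2 m x
    have e7 : u x ^ q = u x ^ p * u x := by
      rw [← Real.rpow_add_one (hpos x).ne', ← hqp]; congr 1; ring
    rw [e1, e2, e3, e4, e5, e6, hqp]
    unfold PE
    unfold En'
    rw [e7]
    have ePs : Ps m u x = Dr u x + m * u x := rfl
    rw [ePs]
    have hmn : (n : ℝ) = 2 * m + 4 := by rw [hm]; ring
    have hmq : 1 / q = m / (2 * m + 4) := by rw [hq, hm]; field_simp; ring
    rw [hmq, hmn]
    have : 2 * m + 4 ≠ 0 := by rw [← hmn]; exact hn0.ne'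
    field_simp
    ring
  simp only [pt]
  rw [integral_add (f := fun x => _ - _) (iW.sub iV) iM, integral_sub iW iV, W, V]
  ring

lemma aux_i1 (L G : ℝ) : L * (2 * G) ≤ L ^ 2 + G ^ 2 := by nlinarith [sq_nonneg (L - G)]
lemma aux_i2 (L G : ℝ) : L * G ≤ L ^ 2 + G ^ 2 := by
  nlinarith [sq_nonneg (L - G), sq_nonneg L, sq_nonneg G]
lemma aux_i3 (L G : ℝ) : (L + G) ^ 2 ≤ 2 * L ^ 2 + 2 * G ^ 2 := by nlinarith [sq_nonneg (L - G)]

set_option maxHeartbeats 1000000 in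
lemma poho_err (hn : 5 ≤ n) {χ : En n → ℝ} {R : ℝ} (hχ : ContDiff ℝ 4 χ)
    (hc : HasCompactSupport χ) : ∃ C : ℝ, 0 ≤ C ∧ ∀ (u : En n → ℝ) (α a : ℝ), ContDiff ℝ 4 u →
    (∀ x, 0 < u x) → 1 ≤ α → α ≤ a → ∀ x, ‖x‖ ≤ R →
    PE α a (2 * (n : ℝ) / ((n : ℝ) - 4)) (((n : ℝ) - 4) / 2) χ u x
      ≤ C * (S2 u x + α * S1 u x + a * u x ^ 2 + u x ^ (2 * (n : ℝ) / ((n : ℝ) - 4))) := by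
  have hn' : (5 : ℝ) ≤ n := by exact_mod_cast hn
  have hn4 : (0 : ℝ) < n - 4 := by linarith
  have hn0 : (0 : ℝ) < n := by linarith
  set q : ℝ := 2 * (n : ℝ) / ((n : ℝ) - 4) with hq
  set m : ℝ := ((n : ℝ) - 4) / 2 with hm
  have hq1 : 1 ≤ q := by rw [hq, le_div_iff₀ hn4]; linarith
  obtain ⟨M1, hM1, bd1⟩ := exists_bd (S1_contDiff hχ (m := 0) (by norm_num)).continuous (S1_cs hc)
  obtain ⟨M3, hM3, bd3⟩ := exists_bd (Lp_contDiff hχ (m := 0) (by norm_num)).continuous (Lp_cs hc)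
  obtain ⟨M4, hM4, bd4⟩ := exists_bd (Dr_contDiff hχ (m := 0) (by norm_num)).continuous (Dr_cs hc)
  set c1 : ℝ := 2 * n + 2 * R ^ 2 * M1 + M4 * n with hc1
  set c2 : ℝ := 2 * (m + 1) ^ 2 * M1 + 2 * R ^ 2 * M3 ^ 2 + 2 * R ^ 2 + M1 + M4 with hc2
  set c3 : ℝ := 2 * m ^ 2 * M3 ^ 2 + 2 * m ^ 2 + M4 with hc3
  have p1 : 0 ≤ c1 := by positivity
  have p2 : 0 ≤ c2 := by positivity
  have p3 : 0 ≤ c3 := by positivity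
  refine ⟨c1 + c2 + c3 + M4, by positivity, fun u α a hu hpos hα ha x hx => ?_⟩
  have hu2 : ContDiff ℝ 2 u := hu.of_le (by norm_num)
  have b1 := (abs_le.1 (bd1 x)).2
  have b3 : Lp' χ x ^ 2 ≤ M3 ^ 2 := by rw [← sq_abs]; exact pow_le_pow_left₀ (abs_nonneg _) (bd3 x) 2
  have b4 := abs_le.1 (bd4 x)
  have hx2 : ‖x‖ ^ 2 ≤ R ^ 2 := pow_le_pow_left₀ (norm_nonneg _) hx 2
  have g1 := Gr_sq_le χ (Ps m u) x
  have g2 := Gr_sq_le u χ x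
  have g3 := S1_Ps_le hu2 m x
  have g4 := Dr_sq_le u x
  have g5 := Lp_sq_le u x
  have ePs : Ps m u x = Dr u x + m * u x := rfl
  have s1 := S1_nonneg u x
  have s2 := S2_nonneg u x
  have s3 := S1_nonneg (Ps m u) x
  have s4 := S1_nonneg χ x
  have hv : 0 ≤ u x ^ q := (Real.rpow_pos_of_pos (hpos x) _).le
  unfold PE
  set L := Lp' u x
  set G1 := Gr χ (Ps m u) x
  set P := Ps m u x
  set l := Lp' χ x
  set G2 := Gr u χ x
  set d := Dr χ x
  set A := S1 u x
  set B := S2 u x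
  set U := u x
  set v := U ^ q
  have a1 : A ≤ α * A := le_mul_of_one_le_left s1 hα
  have a2 : U ^ 2 ≤ α * U ^ 2 := le_mul_of_one_le_left (sq_nonneg _) hα
  have a3 : α * U ^ 2 ≤ a * U ^ 2 := mul_le_mul_of_nonneg_right ha (sq_nonneg _)
  have hP : P ^ 2 ≤ 2 * R ^ 2 * A + 2 * m ^ 2 * U ^ 2 := by
    have : ‖x‖ ^ 2 * A ≤ R ^ 2 * A := mul_le_mul_of_nonneg_right hx2 s1
    rw [ePs]
    have h2 := aux_i3 (Dr u x) (m * U)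
    have h3 : (m * U) ^ 2 = m ^ 2 * U ^ 2 := by ring
    linarith
  have hG1 : G1 ^ 2 ≤ M1 * (2 * (m + 1) ^ 2 * A + 2 * R ^ 2 * B) := by
    have : 2 * ‖x‖ ^ 2 * B ≤ 2 * R ^ 2 * B := mul_le_mul_of_nonneg_right (by linarith) s2
    calc G1 ^ 2 ≤ _ := g1
      _ ≤ M1 * S1 (Ps m u) x := mul_le_mul_of_nonneg_right b1 s3
      _ ≤ _ := mul_le_mul_of_nonneg_left (by linarith) hM1
  have hG2 : G2 ^ 2 ≤ M1 * A := by
    have := mul_le_mul_of_nonneg_left b1 s1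
    linarith
  have t1 : L * (2 * G1) ≤ L ^ 2 + G1 ^ 2 := aux_i1 L G1
  have t2 : L * (P * l) ≤ L ^ 2 + M3 ^ 2 * P ^ 2 := by
    have := mul_le_mul_of_nonneg_right b3 (sq_nonneg P)
    have h2 := aux_i2 L (P * l)
    have h3 : (P * l) ^ 2 = l ^ 2 * P ^ 2 := by ring
    linarith
  have t3 : α * (P * G2) ≤ α * (P ^ 2 + G2 ^ 2) :=
    mul_le_mul_of_nonneg_left (aux_i2 P G2) (by linarith)
  have t4 : - (d * En' α a q u x) ≤ M4 * (n * B + α * A + a * U ^ 2 + v) := by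
    have eE : En' α a q u x = 1 / 2 * (L * L) + α / 2 * A + a / 2 * (U * U) - 1 / q * v := rfl
    have hαA : 0 ≤ α * A := by linarith
    have haU : 0 ≤ a * U ^ 2 := by linarith [sq_nonneg U]
    have hv1 : 1 / q * v ≤ v := by
      apply mul_le_of_le_one_left hv
      rw [div_le_one (by linarith)]; exact hq1
    have hv0 : 0 ≤ 1 / q * v := by positivity
    have hE : |En' α a q u x| ≤ n * B + α * A + a * U ^ 2 + v := by
      rw [eE, abs_le]
      have hLL : L * L = L ^ 2 := by ring
      have hUU : U * U = U ^ 2 := by ring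
      have hL0 := sq_nonneg L
      have hmn1 : a / 2 * (U * U) = (a * U ^ 2) / 2 := by ring
      have hmn2 : α / 2 * A = (α * A) / 2 := by ring
      rw [hmn1, hmn2, hLL]
      constructor <;> linarith
    calc - (d * En' α a q u x) ≤ |d * En' α a q u x| := neg_le_abs _
      _ = |d| * |En' α a q u x| := abs_mul _ _
      _ ≤ _ := mul_le_mul (bd4 x) hE (abs_nonneg _) hM4
  have t5 : M3 ^ 2 * P ^ 2 ≤ M3 ^ 2 * (2 * R ^ 2 * A + 2 * m ^ 2 * U ^ 2) :=
    mul_le_mul_of_nonneg_left hP (sq_nonneg _)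
  have t6 : α * (P ^ 2 + G2 ^ 2) ≤ α * (2 * R ^ 2 * A + 2 * m ^ 2 * U ^ 2 + M1 * A) :=
    mul_le_mul_of_nonneg_left (by linarith) (by linarith)
  have k1 : 2 * (m + 1) ^ 2 * M1 * A ≤ 2 * (m + 1) ^ 2 * M1 * (α * A) :=
    mul_le_mul_of_nonneg_left a1 (by positivity)
  have k2 : 2 * R ^ 2 * M3 ^ 2 * A ≤ 2 * R ^ 2 * M3 ^ 2 * (α * A) :=
    mul_le_mul_of_nonneg_left a1 (by positivity)
  have k3 : 2 * m ^ 2 * M3 ^ 2 * U ^ 2 ≤ 2 * m ^ 2 * M3 ^ 2 * (a * U ^ 2) :=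
    mul_le_mul_of_nonneg_left (a2.trans a3) (by positivity)
  have k4 : 2 * m ^ 2 * (α * U ^ 2) ≤ 2 * m ^ 2 * (a * U ^ 2) :=
    mul_le_mul_of_nonneg_left a3 (by positivity)
  have fin1 : L * (2 * G1 + P * l) + α * (P * G2) - d * En' α a q u x
      ≤ c1 * B + c2 * (α * A) + c3 * (a * U ^ 2) + M4 * v := by
    rw [hc1, hc2, hc3]
    linarith
  have q1 : 0 ≤ α * A := by linarith
  have q2 : 0 ≤ a * U ^ 2 := by linarith [sq_nonneg U]
  have r1 : c1 * B ≤ (c1 + c2 + c3 + M4) * B := mul_le_mul_of_nonneg_right (by linarith) s2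
  have r2 : c2 * (α * A) ≤ (c1 + c2 + c3 + M4) * (α * A) := mul_le_mul_of_nonneg_right (by linarith) q1
  have r3 : c3 * (a * U ^ 2) ≤ (c1 + c2 + c3 + M4) * (a * U ^ 2) := mul_le_mul_of_nonneg_right (by linarith) q2
  have r4 : M4 * v ≤ (c1 + c2 + c3 + M4) * v := mul_le_mul_of_nonneg_right (by linarith) hv
  linarith

end poho

section combination
variable {n : ℕ}

lemma pd_congr {f g : En n → ℝ} {x : En n} (h : f =ᶠ[nhds x] g) (i : Fin n) :
    pderiv' i f =ᶠ[nhds x] pderiv' i g := by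
  filter_upwards [h.fderiv (𝕜 := ℝ)] with y hy
  unfold pderiv'
  rw [hy]

lemma S1_congr {f g : En n → ℝ} {x : En n} (h : f =ᶠ[nhds x] g) : S1 f x = S1 g x := by
  unfold S1
  exact Finset.sum_congr rfl fun i _ => by rw [(pd_congr h i).eq_of_nhds]

lemma S2_congr {f g : En n → ℝ} {x : En n} (h : f =ᶠ[nhds x] g) : S2 f x = S2 g x := by
  unfold S2
  exact Finset.sum_congr rfl fun i _ => S1_congr (pd_congr h i)

lemma pd_const (c : ℝ) (i : Fin n) : pderiv' i (fun _ : En n => c) = fun _ => 0 := by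
  funext x
  unfold pderiv'
  simp

lemma PE_zero {χ : En n → ℝ} {x : En n} {c : ℝ} (h : χ =ᶠ[nhds x] fun _ => c)
    (α a q m : ℝ) (u : En n → ℝ) : PE α a q m χ u x = 0 := by
  have h1 : ∀ i, pderiv' i χ =ᶠ[nhds x] fun _ => 0 := fun i => by
    have := pd_congr h i
    rwa [pd_const] at this
  have h2 : ∀ i, pderiv' i χ x = 0 := fun i => (h1 i).eq_of_nhds
  have h3 : ∀ i, pderiv' i (pderiv' i χ) x = 0 := fun i => by
    rw [(pd_congr (h1 i) i).eq_of_nhds, pd_const]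
  have h4 : Dr χ x = 0 := by
    unfold Dr
    rw [h.fderiv_eq (𝕜 := ℝ)]
    simp
  unfold PE
  rw [h4]
  unfold Gr
  have h5 : Lp' χ x = 0 := by
    unfold Lp'
    exact Finset.sum_eq_zero fun i _ => h3 i
  rw [h5]
  simp [h2]

lemma combo (hn : 5 ≤ n) : ∃ ε : ℝ, 0 < ε ∧ ∀ r R : ℝ, 0 < r → r < R → ∃ C : ℝ, 0 ≤ C ∧
    ∀ (u : En n → ℝ) (α a : ℝ), ContDiff ℝ 4 u → (∀ x, 0 < u x) → 1 ≤ α → α ≤ a →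
    (∀ x, Lp' (Lp' u) x - α * Lp' u x + a * u x = u x ^ (((n : ℝ) + 4) / ((n : ℝ) - 4))) →
    (∫ x in Metric.closedBall 0 R \ Metric.closedBall 0 r,
      u x ^ (2 * (n : ℝ) / ((n : ℝ) - 4))) ≤ ε →
    ∫ x in Metric.closedBall 0 r, (α * S1 u x + 2 * a * u x ^ 2)
      ≤ C * ∫ x in Metric.closedBall 0 R, (S1 u x + (1 + α) * u x ^ 2) := by
  obtain ⟨ε, hε, H⟩ := local_est hn
  refine ⟨ε, hε, fun r R hr hrR => ?_⟩
  obtain ⟨h, hh, hR⟩ : ∃ h : ℝ, 0 < h ∧ R = r + 5 * h :=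
    ⟨(R - r) / 5, by linarith, by ring⟩
  let gi : ContDiffBump (0 : En n) := ⟨r, r + h, hr, by linarith⟩
  let go : ContDiffBump (0 : En n) := ⟨r + 4 * h, R, by linarith, by linarith⟩
  let gc : ContDiffBump (0 : En n) := ⟨r + 2 * h, r + 3 * h, by linarith, by linarith⟩
  set η : En n → ℝ := fun x => go x * (1 - gi x) with hηd
  set χ : En n → ℝ := fun x => gc x with hχd
  have hη : ContDiff ℝ 4 η := go.contDiff.mul (contDiff_const.sub gi.contDiff)
  have hχ : ContDiff ℝ 4 χ := gc.contDiff
  have hχc : HasCompactSupport χ := gc.hasCompactSupport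
  have hη0 : ∀ x, R ≤ ‖x‖ → η x = 0 := fun x hx => by
    have : go x = 0 := go.zero_of_le_dist (by rw [dist_zero_right]; exact hx)
    simp [hηd, this]
  have hηr : ∀ x, ‖x‖ ≤ r → η x = 0 := fun x hx => by
    have : gi x = 1 := gi.one_of_mem_closedBall (by rw [mem_closedBall_zero_iff]; exact hx)
    simp [hηd, this]
  have hη1 : ∀ x, r + h < ‖x‖ → ‖x‖ < r + 4 * h → η =ᶠ[nhds x] fun _ => 1 := fun x h1 h2 => by
    have o1 : IsOpen {y : En n | r + h < ‖y‖} := isOpen_lt continuous_const continuous_norm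
    have o2 : IsOpen {y : En n | ‖y‖ < r + 4 * h} := isOpen_lt continuous_norm continuous_const
    filter_upwards [o1.mem_nhds h1, o2.mem_nhds h2] with y hy1 hy2
    have e1 : gi y = 0 := gi.zero_of_le_dist (by rw [dist_zero_right]; exact le_of_lt hy1)
    have e2 : go y = 1 :=
      go.one_of_mem_closedBall (by rw [mem_closedBall_zero_iff]; exact le_of_lt hy2)
    simp [hηd, e1, e2]
  have hχ1 : ∀ x, ‖x‖ ≤ r + h → χ =ᶠ[nhds x] fun _ => 1 := fun x h1 => by
    have o2 : IsOpen {y : En n | ‖y‖ < r + 2 * h} := isOpen_lt continuous_norm continuous_const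
    have h1' : ‖x‖ < r + 2 * h := by linarith
    filter_upwards [o2.mem_nhds h1'] with y hy2
    exact gc.one_of_mem_closedBall (by rw [mem_closedBall_zero_iff]; exact le_of_lt hy2)
  have hχ0 : ∀ x, r + 4 * h ≤ ‖x‖ → χ =ᶠ[nhds x] fun _ => 0 := fun x h1 => by
    have o2 : IsOpen {y : En n | r + 3 * h < ‖y‖} := isOpen_lt continuous_const continuous_norm
    have h1' : r + 3 * h < ‖x‖ := by linarith
    filter_upwards [o2.mem_nhds h1'] with y hy2
    exact gc.zero_of_le_dist (by rw [dist_zero_right]; exact le_of_lt hy2)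
  obtain ⟨C1, hC1, H1⟩ := H η R hη hη0
  obtain ⟨C2, hC2, H2⟩ := poho_err hn (R := R) hχ hχc
  refine ⟨C2 * C1, by positivity, fun u α a hu hpos hα ha heq hen => ?_⟩
  set q : ℝ := 2 * (n : ℝ) / ((n : ℝ) - 4) with hq
  set m : ℝ := ((n : ℝ) - 4) / 2 with hm
  have hα0 : 0 ≤ α := by linarith
  have ha0 : 0 ≤ a := by linarith
  have cuq : Continuous (fun x => u x ^ q) :=
    hu.continuous.rpow_const fun x => Or.inl (hpos x).ne'
  have cS1 : Continuous (S1 u) := (S1_contDiff hu (m := 0) (by norm_num)).continuous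
  have cu := hu.continuous
  have hqp : ∀ x, 0 ≤ u x ^ q := fun x => (Real.rpow_pos_of_pos (hpos x) _).le
  have hen' : (∫ x in {x | η x ≠ 0}, u x ^ q) ≤ ε := by
    refine le_trans (setIntegral_mono_set ?_ (ae_of_all _ hqp) ?_) hen
    · exact (cuq.continuousOn.integrableOn_compact (isCompact_closedBall 0 R)).mono_set
        Set.sdiff_subset
    · apply Eventually.of_forall
      intro x hx
      have hx' : η x ≠ 0 := hx
      constructor
      · rw [mem_closedBall_zero_iff]
        by_contra hh
        exact hx' (hη0 x (le_of_lt (not_le.1 hh)))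
      · rw [mem_closedBall_zero_iff]
        intro hh
        exact hx' (hηr x hh)
  have K1 := H1 u α a hu hpos hα0 ha0 heq hen'
  have K2 := poho_id hn hχ hχc hu hpos heq
  have cM : Continuous (fun x => α * S1 u x + 2 * a * u x ^ 2) := by fun_prop
  have hM0 : ∀ x, 0 ≤ α * S1 u x + 2 * a * u x ^ 2 := fun x => by
    have := S1_nonneg u x
    positivity
  have iM : Integrable (fun x => χ x * (α * S1 u x + 2 * a * u x ^ 2)) :=
    (hχ.continuous.mul cM).integrable_of_hasCompactSupport hχc.mul_right
  have hχn : ∀ x, 0 ≤ χ x := fun x => gc.nonneg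
  have s1 : ∫ x in Metric.closedBall 0 r, (α * S1 u x + 2 * a * u x ^ 2)
      ≤ ∫ x, χ x * (α * S1 u x + 2 * a * u x ^ 2) := by
    have e : ∫ x in Metric.closedBall 0 r, (α * S1 u x + 2 * a * u x ^ 2)
        = ∫ x in Metric.closedBall 0 r, χ x * (α * S1 u x + 2 * a * u x ^ 2) := by
      apply setIntegral_congr_fun Metric.isClosed_closedBall.measurableSet
      intro x hx
      rw [mem_closedBall_zero_iff] at hx
      have := (hχ1 x (by linarith)).eq_of_nhds
      simp [this]
    rw [e]
    exact setIntegral_le_integral iM (ae_of_all _ fun x => mul_nonneg (hχn x) (hM0 x))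
  set w : En n → ℝ := fun x => η x * u x with hw
  have hwc : ContDiff ℝ 4 w := hη.mul hu
  have hηc : HasCompactSupport η :=
    HasCompactSupport.of_support_subset_isCompact (isCompact_closedBall 0 R) (by
      intro x hx
      rw [mem_closedBall_zero_iff]
      by_contra hh
      exact hx (hη0 x (le_of_lt (not_le.1 hh))))
  have hwcs : HasCompactSupport w := hηc.mul_right
  have i1 : Integrable (S2 w) :=
    (S2_contDiff hwc (m := 0) (by norm_num)).continuous.integrable_of_hasCompactSupport (S2_cs hwcs)
  have i2 : Integrable (S1 w) :=
    (S1_contDiff hwc (m := 0) (by norm_num)).continuous.integrable_of_hasCompactSupport (S1_cs hwcs)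
  have i3 : Integrable (fun x => w x * w x) := int_mul_cs hwc.continuous hwc.continuous hwcs
  have i4 : Integrable (fun x => (η x * u x ^ q) * η x) :=
    int_mul_cs (hη.continuous.mul cuq) hη.continuous hηc
  have iR : Integrable (fun x => C2 * (S2 w x + α * S1 w x + a * w x ^ 2 + η x ^ 2 * u x ^ q)) := by
    have := (((i1.add (i2.const_mul α)).add (i3.const_mul a)).add i4).const_mul C2
    refine this.congr (ae_of_all _ fun x => ?_)
    simp only [Pi.add_apply]
    ring
  have s2 : ∫ x, PE α a q m χ u x
      ≤ ∫ x, C2 * (S2 w x + α * S1 w x + a * w x ^ 2 + η x ^ 2 * u x ^ q) := by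
    have hRn : ∀ x, 0 ≤ C2 * (S2 w x + α * S1 w x + a * w x ^ 2 + η x ^ 2 * u x ^ q) := fun x => by
      have h1 := S1_nonneg w x
      have h2 := S2_nonneg w x
      have h3 := hqp x
      positivity
    by_cases hi : Integrable (PE α a q m χ u)
    · refine integral_mono hi iR fun x => ?_
      by_cases c1 : ‖x‖ ≤ r + h
      · rw [PE_zero (hχ1 x c1)]
        exact hRn x
      by_cases c2 : r + 4 * h ≤ ‖x‖
      · rw [PE_zero (hχ0 x c2)]
        exact hRn x
      have h1 := hη1 x (not_le.1 c1) (not_le.1 c2)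
      have h2 : w =ᶠ[nhds x] u := by
        filter_upwards [h1] with y hy
        simp [hw, hy]
      have h3 := H2 u α a hu hpos hα ha x (by linarith [not_le.1 c2])
      rw [S2_congr h2, S1_congr h2, h2.eq_of_nhds, h1.eq_of_nhds]
      simpa using h3
    · rw [integral_undef hi]
      exact integral_nonneg hRn
  rw [integral_const_mul] at s2
  calc _ ≤ _ := s1
    _ = _ := K2
    _ ≤ _ := s2
    _ ≤ C2 * (C1 * _) := mul_le_mul_of_nonneg_left K1 hC2
    _ = _ := by ring

end combination

section periodic
variable {n : ℕ}

/-- the lattice vector -/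
def lv (k : Fin n → ℤ) : En n := (WithLp.equiv 2 (Fin n → ℝ)).symm (fun i => (k i : ℝ))

lemma lv_apply (k : Fin n → ℤ) (i : Fin n) : lv k i = k i := rfl

lemma per_sub {f : En n → ℝ} (hf : ZPeriodic f) (x : En n) (k : Fin n → ℤ) : f (x - lv k) = f x := by
  have := hf (x - lv k) k
  rw [← this]
  exact congrArg f (sub_add_cancel x (lv k))

lemma pd_per {f : En n → ℝ} (hf : ZPeriodic f) (i : Fin n) : ZPeriodic (pderiv' i f) := by
  intro x k
  unfold pderiv'
  rw [← fderiv_comp_add_right]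
  congr 2
  funext y
  exact hf y k

lemma S1_per {f : En n → ℝ} (hf : ZPeriodic f) : ZPeriodic (S1 f) := by
  intro x k
  unfold S1
  exact Finset.sum_congr rfl fun i _ => by rw [pd_per hf i x k]

lemma cube_sub : unitCube n ⊆ Metric.closedBall (0 : En n) n := by
  intro x hx
  rw [mem_closedBall_zero_iff, EuclideanSpace.norm_eq]
  apply Real.sqrt_le_iff.2
  refine ⟨by positivity, ?_⟩
  have h1 : ∑ i, ‖x i‖ ^ 2 ≤ ∑ i : Fin n, (1 : ℝ) := by
    apply Finset.sum_le_sum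
    intro i _
    rw [Real.norm_eq_abs, sq_abs]
    have := hx i
    nlinarith [this.1, this.2]
  simp only [Finset.sum_const, Finset.card_univ, Fintype.card_fin, nsmul_eq_mul, mul_one] at h1
  refine h1.trans ?_
  norm_cast
  exact Nat.le_self_pow (by norm_num) n

lemma cube_closed : IsClosed (unitCube n) := by
  unfold unitCube
  rw [Set.ofPred_forall]
  exact isClosed_iInter fun i => isClosed_Icc.preimage (by fun_prop)

lemma cube_compact : IsCompact (unitCube n) :=
  (isCompact_closedBall 0 (n : ℝ)).of_isClosed_subset cube_closed cube_sub

lemma cover (ρ : ℝ) : ∃ N : ℝ, 0 ≤ N ∧ ∀ f : En n → ℝ, Continuous f → (∀ x, 0 ≤ f x) → ZPeriodic f →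
    ∫ x in Metric.closedBall 0 ρ, f x ≤ N * ∫ x in unitCube n, f x := by
  let F : Finset (Fin n → ℤ) := Fintype.piFinset fun _ => Finset.Icc ⌊-ρ⌋ ⌊ρ⌋
  refine ⟨F.card, by positivity, fun f hf h0 hper => ?_⟩
  set g : En n → ℝ := (unitCube n).indicator f with hg
  have hg0 : ∀ x, 0 ≤ g x := fun x => Set.indicator_nonneg (fun y _ => h0 y) x
  have hgi : Integrable g := by
    rw [hg, integrable_indicator_iff cube_closed.measurableSet]
    exact hf.continuousOn.integrableOn_compact cube_compact
  have hb : Integrable ((Metric.closedBall (0 : En n) ρ).indicator f) := by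
    rw [integrable_indicator_iff Metric.isClosed_closedBall.measurableSet]
    exact hf.continuousOn.integrableOn_compact (isCompact_closedBall 0 ρ)
  have hs : Integrable (fun x => ∑ k ∈ F, g (x - lv k)) :=
    integrable_finsetSum _ fun k _ => hgi.comp_sub_right (lv k)
  rw [← integral_indicator Metric.isClosed_closedBall.measurableSet,
    ← integral_indicator cube_closed.measurableSet]
  calc _ ≤ ∫ x, ∑ k ∈ F, g (x - lv k) := by
        refine integral_mono hb hs fun x => ?_
        by_cases hx : x ∈ Metric.closedBall (0 : En n) ρ
        · rw [Set.indicator_of_mem hx]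
          let k : Fin n → ℤ := fun i => ⌊x i⌋
          have hk : k ∈ F := by
            rw [Fintype.mem_piFinset]
            intro i
            rw [mem_closedBall_zero_iff] at hx
            have h1 : |x i| ≤ ρ := (PiLp.norm_apply_le x i).trans hx
            rw [abs_le] at h1
            rw [Finset.mem_Icc]
            exact ⟨Int.floor_le_floor h1.1, Int.floor_le_floor h1.2⟩
          have hxk : x - lv k ∈ unitCube n := by
            intro i
            have e : (x - lv k) i = x i - ⌊x i⌋ := rfl
            rw [e]
            exact ⟨by linarith [Int.floor_le (x i)], by linarith [Int.lt_floor_add_one (x i)]⟩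
          have e : g (x - lv k) = f x := by
            rw [hg, Set.indicator_of_mem hxk, per_sub hper]
          rw [← e]
          exact Finset.single_le_sum (f := fun k => g (x - lv k)) (fun k _ => hg0 _) hk
        · rw [Set.indicator_of_notMem hx]
          exact Finset.sum_nonneg fun k _ => hg0 _
    _ = ∑ k ∈ F, ∫ x, g (x - lv k) := integral_finsetSum _ fun k _ => hgi.comp_sub_right (lv k)
    _ = ∑ k ∈ F, ∫ x, g x := Finset.sum_congr rfl fun k _ => integral_sub_right_eq_self g (lv k)
    _ = _ := by rw [Finset.sum_const, nsmul_eq_mul]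

end periodic

section final
variable {n : ℕ}

lemma lap_eq (u : En n → ℝ) : lap u = fun x => - Lp' u x := rfl

lemma pd_neg (f : En n → ℝ) (i : Fin n) : pderiv' i (fun x => - f x) = fun x => - pderiv' i f x := by
  funext x
  unfold pderiv'
  rw [fderiv_fun_neg]
  rfl

lemma lap_lap (u : En n → ℝ) (x : En n) : lap (lap u) x = Lp' (Lp' u) x := by
  rw [lap_eq u]
  unfold lap Lp'
  simp only [pd_neg, Finset.sum_neg_distrib, neg_neg]

lemma cube_pos : 0 < volume (unitCube n) := by
  have ho : IsOpen {x : En n | ∀ i, x i ∈ Set.Ioo (0 : ℝ) 1} := by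
    rw [Set.ofPred_forall]
    exact isOpen_iInter_of_finite fun i => isOpen_Ioo.preimage (by fun_prop)
  have hne : {x : En n | ∀ i, x i ∈ Set.Ioo (0 : ℝ) 1}.Nonempty :=
    ⟨WithLp.toLp 2 (fun _ => 1 / 2), fun i => by constructor <;> norm_num⟩
  exact (ho.measure_pos volume hne).trans_le
    (measure_mono fun x hx i => Set.Ioo_subset_Icc_self (hx i))

/-- One of the annuli has small energy. -/
lemma pigeon (I : ℕ → ℝ) (K : ℕ) (ε T : ℝ) (h0 : 0 ≤ I 0) (hK : I K ≤ T) (hT : T < K * ε) :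
    ∃ j ∈ Finset.range K, I (j + 1) - I j ≤ ε := by
  by_contra hcon
  push Not at hcon
  have h1 : ∑ j ∈ Finset.range K, ε ≤ ∑ j ∈ Finset.range K, (I (j + 1) - I j) :=
    Finset.sum_le_sum fun j hj => (hcon j hj).le
  rw [Finset.sum_range_sub, Finset.sum_const, Finset.card_range, nsmul_eq_mul] at h1
  linarith

lemma no_sol {u : En n → ℝ} {α a D : ℝ} (hu : ContDiff ℝ 4 u) (hpos : ∀ x, 0 < u x)
    (ha : 0 < a) (h1 : D ≤ α) (h2 : D * (1 + α) ≤ a)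
    (h : ∫ x in unitCube n, (α * S1 u x + 2 * a * u x ^ 2)
      ≤ D * ∫ x in unitCube n, (S1 u x + (1 + α) * u x ^ 2)) : False := by
  have cS1 : Continuous (S1 u) := (S1_contDiff hu (m := 0) (by norm_num)).continuous
  have cu := hu.continuous
  have I : ∀ f : En n → ℝ, Continuous f → IntegrableOn f (unitCube n) := fun f hf =>
    hf.continuousOn.integrableOn_compact cube_compact
  have i1 := I (fun x => α * S1 u x + 2 * a * u x ^ 2) (by fun_prop)
  have i2 := I (fun x => D * (S1 u x + (1 + α) * u x ^ 2)) (by fun_prop)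
  have i3 := I (fun x => a * u x ^ 2) (by fun_prop)
  rw [← integral_const_mul] at h
  have h3 : ∫ x in unitCube n, (D * (S1 u x + (1 + α) * u x ^ 2) + a * u x ^ 2)
      ≤ ∫ x in unitCube n, (α * S1 u x + 2 * a * u x ^ 2) := by
    refine setIntegral_mono (i2.add i3) i1 fun x => ?_
    have k1 := mul_le_mul_of_nonneg_right h1 (S1_nonneg u x)
    have k2 := mul_le_mul_of_nonneg_right h2 (sq_nonneg (u x))
    show D * (S1 u x + (1 + α) * u x ^ 2) + a * u x ^ 2 ≤ α * S1 u x + 2 * a * u x ^ 2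
    linarith
  rw [integral_add i2 i3] at h3
  have h4 : 0 < ∫ x in unitCube n, a * u x ^ 2 := by
    rw [setIntegral_pos_iff_support_of_nonneg_ae
      (ae_of_all _ fun x => by have := hpos x; positivity) i3]
    have : Function.support (fun x => a * u x ^ 2) = Set.univ := by
      ext x
      simp only [Function.mem_support, Set.mem_univ, iff_true]
      have := hpos x
      positivity
    rw [this, Set.univ_inter]
    exact cube_pos
  linarith

end final

/-- Extension (2.1) of Theorem 0.1 on the flat torus: under (A1) `a(α) ≤ α²/4` and
(A2) `a(α)/α → +∞`, for every `Λ > 0` there is `α₀ > 0` such that for `α ≥ α₀` there is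
no positive `ℤⁿ`-periodic `C⁴` solution of `Δ²u + αΔu + a(α)u = u^{2♯-1}` with energy
`∫_{[0,1]ⁿ} u^{2♯} ≤ Λ`. -/
theorem energy_function_tendsto_infinity_general_torus (n : ℕ) (hn : 5 ≤ n)
    (a : ℝ → ℝ) (ha_pos : ∀ α : ℝ, 0 < α → 0 < a α)
    (hA1 : ∀ α : ℝ, 0 < α → a α ≤ α ^ 2 / 4)
    (hA2 : Filter.Tendsto (fun α => a α / α) Filter.atTop Filter.atTop) :
    ∀ Λ : ℝ, 0 < Λ → ∃ α₀ : ℝ, 0 < α₀ ∧ ∀ α : ℝ, α₀ ≤ α →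
      ¬ ∃ u : En n → ℝ, ContDiff ℝ 4 u ∧ (∀ x, 0 < u x) ∧ ZPeriodic u ∧
          (∀ x : En n,
            lap (lap u) x + α * lap u x + a α * u x
            = u x ^ (((n : ℝ) + 4) / ((n : ℝ) - 4))) ∧
          (∫ x in unitCube n, u x ^ (2 * (n : ℝ) / ((n : ℝ) - 4))) ≤ Λ := by
  intro Λ hΛ
  obtain ⟨ε, hε, H⟩ := combo hn
  obtain ⟨N, hN, hcov⟩ := cover (n := n) ((n : ℝ) + 1)
  have hn' : (5 : ℝ) ≤ n := by exact_mod_cast hn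
  obtain ⟨K, hK⟩ := exists_nat_gt (N * Λ / ε)
  have hK0 : (0 : ℝ) < K := lt_of_le_of_lt (by positivity) hK
  rw [div_lt_iff₀ hε] at hK
  let ρ : ℕ → ℝ := fun j => n + j / K
  have hρ : ∀ j, ρ j < ρ (j + 1) := fun j => by
    have : (j : ℝ) / K < ((j + 1 : ℕ) : ℝ) / K := by
      apply div_lt_div_of_pos_right _ hK0
      push_cast
      linarith
    exact add_lt_add_right this _
  have hρ0 : ∀ j, (n : ℝ) ≤ ρ j := fun j => le_add_of_nonneg_right (by positivity)
  have hρK : ρ K = n + 1 := by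
    show (n : ℝ) + (K : ℝ) / K = n + 1
    rw [div_self hK0.ne']
  have hmono : Monotone ρ := monotone_nat_of_le_succ fun j => (hρ j).le
  have H' := fun j => H (ρ j) (ρ (j + 1)) (by linarith [hρ0 j]) (hρ j)
  choose C hC0 hC using H'
  set D : ℝ := (∑ j ∈ Finset.range K, C j) * N with hD
  have hD0 : 0 ≤ D := mul_nonneg (Finset.sum_nonneg fun j _ => hC0 j) hN
  obtain ⟨α₁, hα₁⟩ := Filter.eventually_atTop.1 (hA2.eventually_ge_atTop (2 * D + 1))
  refine ⟨max (max 1 D) α₁, lt_of_lt_of_le one_pos ((le_max_left _ _).trans (le_max_left _ _)), ?_⟩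
  rintro α hα ⟨u, hu, hpos, hper, heq, hen⟩
  have hα1 : 1 ≤ α := ((le_max_left _ _).trans (le_max_left _ _)).trans hα
  have hαD : D ≤ α := ((le_max_right _ _).trans (le_max_left _ _)).trans hα
  have hα0 : 0 < α := by linarith
  have haα := hα₁ α ((le_max_right _ _).trans hα)
  rw [le_div_iff₀ hα0] at haα
  have hDα : D ≤ D * α := le_mul_of_one_le_right hD0 hα1
  have ha1 : α ≤ a α := by linarith
  have ha2 : D * (1 + α) ≤ a α := by linarith
  have heq' : ∀ x, Lp' (Lp' u) x - α * Lp' u x + a α * u x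
      = u x ^ (((n : ℝ) + 4) / ((n : ℝ) - 4)) := fun x => by
    rw [← heq x, lap_lap, lap_eq]
    ring
  have cuq : Continuous (fun x => u x ^ (2 * (n : ℝ) / ((n : ℝ) - 4))) :=
    hu.continuous.rpow_const fun x => Or.inl (hpos x).ne'
  have huq0 : ∀ x, 0 ≤ u x ^ (2 * (n : ℝ) / ((n : ℝ) - 4)) := fun x =>
    (Real.rpow_pos_of_pos (hpos x) _).le
  have iuq : ∀ r : ℝ, IntegrableOn (fun x => u x ^ (2 * (n : ℝ) / ((n : ℝ) - 4)))
      (Metric.closedBall (0 : En n) r) := fun r =>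
    cuq.continuousOn.integrableOn_compact (isCompact_closedBall 0 r)
  have hE := hcov _ cuq huq0 (fun x k => by
    show u (x + _) ^ _ = _
    rw [hper x k])
  obtain ⟨j, hj, hje⟩ := pigeon
    (fun j => ∫ x in Metric.closedBall (0 : En n) (ρ j), u x ^ (2 * (n : ℝ) / ((n : ℝ) - 4)))
    K ε (N * Λ) (integral_nonneg huq0)
    (by
      show ∫ x in Metric.closedBall (0 : En n) (ρ K), _ ≤ _
      rw [hρK]
      exact hE.trans (mul_le_mul_of_nonneg_left hen hN)) hK
  have hann : (∫ x in Metric.closedBall (0 : En n) (ρ (j + 1)) \ Metric.closedBall 0 (ρ j),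
      u x ^ (2 * (n : ℝ) / ((n : ℝ) - 4))) ≤ ε := by
    rw [setIntegral_sdiff Metric.isClosed_closedBall.measurableSet (iuq _)
      (Metric.closedBall_subset_closedBall (hρ j).le)]
    exact hje
  have key := hC j u α (a α) hu hpos hα1 ha1 heq' hann
  have cS1 : Continuous (S1 u) := (S1_contDiff hu (m := 0) (by norm_num)).continuous
  have cu := hu.continuous
  have cM : Continuous (fun x => α * S1 u x + 2 * a α * u x ^ 2) := by fun_prop
  have cJ : Continuous (fun x => S1 u x + (1 + α) * u x ^ 2) := by fun_prop
  have hM0 : ∀ x, 0 ≤ α * S1 u x + 2 * a α * u x ^ 2 := fun x => by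
    have h1 := S1_nonneg u x
    have h2 := ha_pos α hα0
    positivity
  have hJ0 : ∀ x, 0 ≤ S1 u x + (1 + α) * u x ^ 2 := fun x => by
    have h1 := S1_nonneg u x
    positivity
  have hJper : ZPeriodic (fun x => S1 u x + (1 + α) * u x ^ 2) := fun x k => by
    show S1 u (x + _) + (1 + α) * u (x + _) ^ 2 = _
    rw [S1_per hper x k, hper x k]
  have hJ := hcov _ cJ hJ0 hJper
  have hj1 : ρ (j + 1) ≤ n + 1 := by
    rw [← hρK]
    exact hmono (Finset.mem_range.1 hj)
  refine no_sol hu hpos (ha_pos α hα0) hαD ha2 ?_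
  calc ∫ x in unitCube n, (α * S1 u x + 2 * a α * u x ^ 2)
      ≤ ∫ x in Metric.closedBall 0 (ρ j), (α * S1 u x + 2 * a α * u x ^ 2) :=
        setIntegral_mono_set (cM.continuousOn.integrableOn_compact (isCompact_closedBall 0 _))
          (ae_of_all _ hM0)
          (cube_sub.trans (Metric.closedBall_subset_closedBall (hρ0 j))).eventuallyLE
    _ ≤ C j * ∫ x in Metric.closedBall 0 (ρ (j + 1)), (S1 u x + (1 + α) * u x ^ 2) := key
    _ ≤ C j * (N * ∫ x in unitCube n, (S1 u x + (1 + α) * u x ^ 2)) := by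
        refine mul_le_mul_of_nonneg_left (le_trans ?_ hJ) (hC0 j)
        exact setIntegral_mono_set
          (cJ.continuousOn.integrableOn_compact (isCompact_closedBall 0 _))
          (ae_of_all _ hJ0) (Metric.closedBall_subset_closedBall hj1).eventuallyLE
    _ ≤ (∑ j ∈ Finset.range K, C j) * (N * ∫ x in unitCube n, (S1 u x + (1 + α) * u x ^ 2)) := by
        apply mul_le_mul_of_nonneg_right
        · exact Finset.single_le_sum (fun j _ => hC0 j) hj
        · exact mul_nonneg hN (integral_nonneg hJ0)
    _ = D * ∫ x in unitCube n, (S1 u x + (1 + α) * u x ^ 2) := by rw [hD]; ring
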